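/- Let (f,g,ρ) be a warped Berger solution of Ricci flow on S^1×S^3 defined on [0,T) satisfying Assumption B. Then for every sufficiently small δ ∈ (0,1) there exist t_δ ∈ [0,T) and a constant C < ∞ such that the quantity F := f·f_{ss}·log f satisfies F ≥ −C (equivalently, f·f_{ss}·|log f| ≤ C) at every point (ξ,t) with t_δ < t < T, f(ξ,t) ≤ δ, and f_{ss}(ξ,t) ≥ 0 (i.e. throughout the neck-like region). -/

import Mathlib

open Real Set Filter Topology

noncomputable section

/-- Partial derivative in the first (spatial, `ξ`) variable. -/
def pd1 (φ : ℝ → ℝ → ℝ) (ξ t : ℝ) : ℝ := deriv (fun x => φ x t) ξ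

/-- Partial derivative in the second (time) variable: `φ_t`. -/
def pdt (φ : ℝ → ℝ → ℝ) (ξ t : ℝ) : ℝ := deriv (fun τ => φ ξ τ) t

/-- Derivative with respect to arclength `s` (where `ds = ρ dξ`): `φ_s := ρ⁻¹ ∂_ξ φ`. -/
def Ds (ρ φ : ℝ → ℝ → ℝ) (ξ t : ℝ) : ℝ := pd1 φ ξ t / ρ ξ t

/-- Sectional curvature `κ₁₂ = κ₃₁ = f²/g⁴ − f_s g_s/(f g)`. -/
def k12 (ρ f g : ℝ → ℝ → ℝ) (ξ t : ℝ) : ℝ :=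
  (f ξ t) ^ 2 / (g ξ t) ^ 4 - Ds ρ f ξ t * Ds ρ g ξ t / (f ξ t * g ξ t)

/-- Sectional curvature `κ₃₁ = κ₁₂`. -/
def k31 (ρ f g : ℝ → ℝ → ℝ) (ξ t : ℝ) : ℝ :=
  (f ξ t) ^ 2 / (g ξ t) ^ 4 - Ds ρ f ξ t * Ds ρ g ξ t / (f ξ t * g ξ t)

/-- Sectional curvature `κ₂₃ = (4g² − 3f²)/g⁴ − g_s²/g²`. -/
def k23 (ρ f g : ℝ → ℝ → ℝ) (ξ t : ℝ) : ℝ :=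
  (4 * (g ξ t) ^ 2 - 3 * (f ξ t) ^ 2) / (g ξ t) ^ 4 - (Ds ρ g ξ t) ^ 2 / (g ξ t) ^ 2

/-- Sectional curvature `κ₀₁ = −f_ss/f`. -/
def k01 (ρ f : ℝ → ℝ → ℝ) (ξ t : ℝ) : ℝ := -(Ds ρ (Ds ρ f) ξ t) / f ξ t

/-- Sectional curvature `κ₀₂ = κ₀₃ = −g_ss/g`. -/
def k02 (ρ g : ℝ → ℝ → ℝ) (ξ t : ℝ) : ℝ := -(Ds ρ (Ds ρ g) ξ t) / g ξ t

/-- Scalar curvature `R = κ₀₁ + 2κ₀₂ + 2κ₁₂ + κ₂₃`. -/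
def scalR (ρ f g : ℝ → ℝ → ℝ) (ξ t : ℝ) : ℝ :=
  k01 ρ f ξ t + 2 * k02 ρ g ξ t + 2 * k12 ρ f g ξ t + k23 ρ f g ξ t

/-- `M(ξ,t) := min {f(ξ,t), g(ξ,t)}`. -/
def M (f g : ℝ → ℝ → ℝ) (ξ t : ℝ) : ℝ := min (f ξ t) (g ξ t)

/-- `M̌(t) := min_{ξ ∈ S¹} M(ξ,t)`. -/
def Mcheck (f g : ℝ → ℝ → ℝ) (t : ℝ) : ℝ := ⨅ ξ : ℝ, M f g ξ t

/-- A warped Berger solution of Ricci flow on `S¹ × S³` with (finite) existence time `T`: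
smooth positive `2π`-periodic-in-`ξ` functions `f, g, ρ` on `S¹ × [0,T)` satisfying
  `f_t = f_ss + 2 (g_s/g) f_s − 2 f³/g⁴`,
  `g_t = g_ss + (f_s/f + g_s/g) g_s + 2 (f² − 2g²)/g³`,
  `(log ρ)_t = f_ss/f + 2 g_ss/g`. -/
structure WarpedBerger (T : ℝ) (f g ρ : ℝ → ℝ → ℝ) : Prop where
  T_pos : 0 < T
  f_pos : ∀ ξ t : ℝ, 0 ≤ t → t < T → 0 < f ξ t
  g_pos : ∀ ξ t : ℝ, 0 ≤ t → t < T → 0 < g ξ t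
  ρ_pos : ∀ ξ t : ℝ, 0 ≤ t → t < T → 0 < ρ ξ t
  f_per : ∀ ξ t : ℝ, f (ξ + 2 * π) t = f ξ t
  g_per : ∀ ξ t : ℝ, g (ξ + 2 * π) t = g ξ t
  ρ_per : ∀ ξ t : ℝ, ρ (ξ + 2 * π) t = ρ ξ t
  smooth : ContDiffOn ℝ (⊤ : ℕ∞)
      (fun p : ℝ × ℝ => (f p.1 p.2, g p.1 p.2, ρ p.1 p.2)) (Set.univ ×ˢ Set.Ico 0 T)
  eq_f : ∀ ξ t : ℝ, 0 < t → t < T →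
    pdt f ξ t = Ds ρ (Ds ρ f) ξ t + 2 * (Ds ρ g ξ t / g ξ t) * Ds ρ f ξ t
      - 2 * (f ξ t) ^ 3 / (g ξ t) ^ 4
  eq_g : ∀ ξ t : ℝ, 0 < t → t < T →
    pdt g ξ t = Ds ρ (Ds ρ g) ξ t
      + (Ds ρ f ξ t / f ξ t + Ds ρ g ξ t / g ξ t) * Ds ρ g ξ t
      + 2 * ((f ξ t) ^ 2 - 2 * (g ξ t) ^ 2) / (g ξ t) ^ 3
  eq_ρ : ∀ ξ t : ℝ, 0 < t → t < T →
    pdt (fun x τ => Real.log (ρ x τ)) ξ t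
      = Ds ρ (Ds ρ f) ξ t / f ξ t + 2 * (Ds ρ (Ds ρ g) ξ t / g ξ t)

/-- The Ricci curvature blows up as `t ↗ T`:
`limsup_{t↗T} max_ξ (|κ₀₁+2κ₁₂| + |κ₀₁+2κ₀₂| + |κ₀₂+κ₁₂+κ₂₃|) = ∞`, where the three
displayed quantities are the diagonal components of the Ricci tensor. -/
def RicciBlowup (T : ℝ) (f g ρ : ℝ → ℝ → ℝ) : Prop :=
  ∀ K : ℝ, ∀ t₀ : ℝ, 0 ≤ t₀ → t₀ < T → ∃ ξ t : ℝ, t₀ < t ∧ t < T ∧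
    K < |k01 ρ f ξ t + 2 * k12 ρ f g ξ t| + |k01 ρ f ξ t + 2 * k02 ρ g ξ t|
        + |k02 ρ g ξ t + k12 ρ f g ξ t + k23 ρ f g ξ t|

/-- Assumption A: `f ≤ g` at `t = 0`; `(min_ξ R(ξ,0))·(max_ξ g(ξ,0)²) > −3`;
and the Ricci curvature blows up at the finite time `T`. -/
structure AssumptionA (T : ℝ) (f g ρ : ℝ → ℝ → ℝ) extends WarpedBerger T f g ρ : Prop where
  init_order : ∀ ξ : ℝ, f ξ 0 ≤ g ξ 0
  init_scalar : (⨅ ξ : ℝ, scalR ρ f g ξ 0) * (⨆ ξ : ℝ, (g ξ 0) ^ 2) > -3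
  ricci_blowup : RicciBlowup T f g ρ

/-- Assumption B: Assumption A and, in addition, at `t = 0` one has `f ≥ (1−ε)g` for some
`ε ∈ (0,1)` with `2(1−ε)⁵ + 4(1−ε)⁴ > 4/3`, and `|f_s| ≤ 1` at `t = 0`. -/
structure AssumptionB (T : ℝ) (f g ρ : ℝ → ℝ → ℝ) extends AssumptionA T f g ρ : Prop where
  init_pinched : ∃ ε : ℝ, 0 < ε ∧ ε < 1 ∧ 2 * (1 - ε) ^ 5 + 4 * (1 - ε) ^ 4 > 4 / 3 ∧
    ∀ ξ : ℝ, (1 - ε) * g ξ 0 ≤ f ξ 0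
  init_fs : ∀ ξ : ℝ, |Ds ρ f ξ 0| ≤ 1


/-! Calculus on the open space-time strip. -/

def Sm (T : ℝ) (φ : ℝ → ℝ → ℝ) : Prop :=
  ContDiffOn ℝ (⊤ : ℕ∞) (fun p : ℝ × ℝ => φ p.1 p.2) (Set.univ ×ˢ Set.Ioo 0 T)

lemma strip_open (T : ℝ) : IsOpen ((Set.univ : Set ℝ) ×ˢ Set.Ioo (0:ℝ) T) :=
  isOpen_univ.prod isOpen_Ioo

lemma Sm.cda {T : ℝ} {φ : ℝ → ℝ → ℝ} (h : Sm T φ) {ξ t : ℝ} (h0 : 0 < t) (h1 : t < T) :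
    ContDiffAt ℝ (⊤ : ℕ∞) (fun p : ℝ × ℝ => φ p.1 p.2) (ξ, t) :=
  h.contDiffAt ((strip_open T).mem_nhds ⟨trivial, h0, h1⟩)

lemma Sm.hx' {T : ℝ} {φ : ℝ → ℝ → ℝ} (h : Sm T φ) {ξ t : ℝ} (h0 : 0 < t) (h1 : t < T) :
    HasDerivAt (fun x => φ x t) (fderiv ℝ (fun p : ℝ × ℝ => φ p.1 p.2) (ξ, t) (1, 0)) ξ := by
  have hd : HasFDerivAt (fun p : ℝ × ℝ => φ p.1 p.2) _ (ξ, t) :=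
    ((h.cda (ξ := ξ) h0 h1).differentiableAt (by simp)).hasFDerivAt
  have hc : HasDerivAt (fun x : ℝ => (x, t)) ((1 : ℝ), (0 : ℝ)) ξ :=
    (hasDerivAt_id ξ).prodMk (hasDerivAt_const ξ t)
  exact hd.comp_hasDerivAt ξ hc

lemma Sm.ht' {T : ℝ} {φ : ℝ → ℝ → ℝ} (h : Sm T φ) {ξ t : ℝ} (h0 : 0 < t) (h1 : t < T) :
    HasDerivAt (fun x => φ ξ x) (fderiv ℝ (fun p : ℝ × ℝ => φ p.1 p.2) (ξ, t) (0, 1)) t := by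
  have hd : HasFDerivAt (fun p : ℝ × ℝ => φ p.1 p.2) _ (ξ, t) :=
    ((h.cda (ξ := ξ) h0 h1).differentiableAt (by simp)).hasFDerivAt
  have hc : HasDerivAt (fun x : ℝ => (ξ, x)) ((0 : ℝ), (1 : ℝ)) t :=
    (hasDerivAt_const t ξ).prodMk (hasDerivAt_id t)
  exact hd.comp_hasDerivAt t hc

lemma Sm.pd1_eq {T : ℝ} {φ : ℝ → ℝ → ℝ} (h : Sm T φ) {ξ t : ℝ} (h0 : 0 < t) (h1 : t < T) :
    pd1 φ ξ t = fderiv ℝ (fun p : ℝ × ℝ => φ p.1 p.2) (ξ, t) (1, 0) := (h.hx' h0 h1).deriv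

lemma Sm.pdt_eq {T : ℝ} {φ : ℝ → ℝ → ℝ} (h : Sm T φ) {ξ t : ℝ} (h0 : 0 < t) (h1 : t < T) :
    pdt φ ξ t = fderiv ℝ (fun p : ℝ × ℝ => φ p.1 p.2) (ξ, t) (0, 1) := (h.ht' h0 h1).deriv

lemma Sm.hx {T : ℝ} {φ : ℝ → ℝ → ℝ} (h : Sm T φ) {ξ t : ℝ} (h0 : 0 < t) (h1 : t < T) :
    HasDerivAt (fun x => φ x t) (pd1 φ ξ t) ξ := by
  rw [h.pd1_eq h0 h1]; exact h.hx' h0 h1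

lemma Sm.ht {T : ℝ} {φ : ℝ → ℝ → ℝ} (h : Sm T φ) {ξ t : ℝ} (h0 : 0 < t) (h1 : t < T) :
    HasDerivAt (fun x => φ ξ x) (pdt φ ξ t) t := by
  rw [h.pdt_eq h0 h1]; exact h.ht' h0 h1

lemma Sm.pd1 {T : ℝ} {φ : ℝ → ℝ → ℝ} (h : Sm T φ) : Sm T (pd1 φ) := by
  have h2 : ContDiffOn ℝ (⊤ : ℕ∞) (fderiv ℝ (fun p : ℝ × ℝ => φ p.1 p.2))
      (Set.univ ×ˢ Set.Ioo 0 T) := h.fderiv_of_isOpen (strip_open T) (by simp)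
  have h3 := h2.clm_apply (contDiffOn_const (c := ((1 : ℝ), (0 : ℝ))))
  refine ContDiffOn.congr h3 ?_
  rintro ⟨ξ, t⟩ ⟨-, h0, h1⟩
  exact h.pd1_eq h0 h1

lemma Sm.pdt {T : ℝ} {φ : ℝ → ℝ → ℝ} (h : Sm T φ) : Sm T (pdt φ) := by
  have h2 : ContDiffOn ℝ (⊤ : ℕ∞) (fderiv ℝ (fun p : ℝ × ℝ => φ p.1 p.2))
      (Set.univ ×ˢ Set.Ioo 0 T) := h.fderiv_of_isOpen (strip_open T) (by simp)
  have h3 := h2.clm_apply (contDiffOn_const (c := ((0 : ℝ), (1 : ℝ))))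
  refine ContDiffOn.congr h3 ?_
  rintro ⟨ξ, t⟩ ⟨-, h0, h1⟩
  exact h.pdt_eq h0 h1

lemma Sm.comm {T : ℝ} {φ : ℝ → ℝ → ℝ} (h : Sm T φ) {ξ t : ℝ} (h0 : 0 < t) (h1 : t < T) :
    _root_.pdt (_root_.pd1 φ) ξ t = _root_.pd1 (_root_.pdt φ) ξ t := by
  have hd2 : ContDiffOn ℝ (⊤ : ℕ∞) (fderiv ℝ (fun p : ℝ × ℝ => φ p.1 p.2))
      (Set.univ ×ˢ Set.Ioo 0 T) := h.fderiv_of_isOpen (strip_open T) (by simp)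
  have hda : HasFDerivAt (fderiv ℝ (fun p : ℝ × ℝ => φ p.1 p.2)) _ (ξ, t) :=
    ((hd2.contDiffAt ((strip_open T).mem_nhds ⟨trivial, h0, h1⟩)).differentiableAt
      (by simp)).hasFDerivAt
  have hs : IsSymmSndFDerivAt ℝ (fun p : ℝ × ℝ => φ p.1 p.2) (ξ, t) :=
    (h.cda h0 h1).isSymmSndFDerivAt (by
      simp only [minSmoothness_of_isRCLikeNormedField]
      exact (WithTop.coe_le_coe (b := (2 : ℕ∞))).2 le_top)
  have key := hs.eq (1, 0) (0, 1)
  have c1 : HasDerivAt (fun x : ℝ => (x, t)) ((1 : ℝ), (0 : ℝ)) ξ :=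
    (hasDerivAt_id ξ).prodMk (hasDerivAt_const ξ t)
  have c2 : HasDerivAt (fun x : ℝ => (ξ, x)) ((0 : ℝ), (1 : ℝ)) t :=
    (hasDerivAt_const t ξ).prodMk (hasDerivAt_id t)
  set D := fderiv ℝ (fun p : ℝ × ℝ => φ p.1 p.2) with hD
  set D2 := fderiv ℝ D (ξ, t) with hD2
  have g1 : HasDerivAt (fun x => D (x, t)) (D2 (1, 0)) ξ := hda.comp_hasDerivAt ξ c1
  have g2 : HasDerivAt (fun x => D (ξ, x)) (D2 (0, 1)) t := hda.comp_hasDerivAt t c2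
  have e1 : HasDerivAt (fun x => D (x, t) (0, 1)) (D2 (1, 0) (0, 1)) ξ := by
    simpa using g1.clm_apply (hasDerivAt_const ξ ((0 : ℝ), (1 : ℝ)))
  have e2 : HasDerivAt (fun x => D (ξ, x) (1, 0)) (D2 (0, 1) (1, 0)) t := by
    simpa using g2.clm_apply (hasDerivAt_const t ((1 : ℝ), (0 : ℝ)))
  have f1 : _root_.pd1 (_root_.pdt φ) ξ t = D2 (1, 0) (0, 1) := by
    refine HasDerivAt.deriv (HasDerivAt.congr_of_eventuallyEq e1 ?_)
    exact Filter.Eventually.of_forall fun x => h.pdt_eq h0 h1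
  have f2 : _root_.pdt (_root_.pd1 φ) ξ t = D2 (0, 1) (1, 0) := by
    refine HasDerivAt.deriv (HasDerivAt.congr_of_eventuallyEq e2 ?_)
    filter_upwards [isOpen_Ioo.mem_nhds (show t ∈ Set.Ioo 0 T from ⟨h0, h1⟩)] with x hx
    exact h.pd1_eq hx.1 hx.2
  rw [f1, f2]
  exact key.symm

lemma Sm.Ds {T : ℝ} {ρ φ : ℝ → ℝ → ℝ} (hρ : Sm T ρ)
    (pos : ∀ ξ t : ℝ, 0 ≤ t → t < T → 0 < ρ ξ t) (h : Sm T φ) : Sm T (Ds ρ φ) := by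
  refine ContDiffOn.div h.pd1 hρ ?_
  rintro ⟨ξ, t⟩ ⟨-, h0, h1⟩
  exact (pos ξ t h0.le h1).ne'

lemma Sm.cont {T a : ℝ} {φ : ℝ → ℝ → ℝ} (h : Sm T φ) (ha : 0 < a) :
    ContinuousOn (fun p : ℝ × ℝ => φ p.1 p.2) (Set.univ ×ˢ Set.Ico a T) :=
  h.continuousOn.mono (Set.prod_mono le_rfl (fun _ hx => ⟨lt_of_lt_of_le ha hx.1, hx.2⟩))

lemma Ds_per {ρ φ : ℝ → ℝ → ℝ} (h1 : ∀ ξ t : ℝ, ρ (ξ + 2 * π) t = ρ ξ t)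
    (h2 : ∀ ξ t : ℝ, φ (ξ + 2 * π) t = φ ξ t) (ξ t : ℝ) :
    Ds ρ φ (ξ + 2 * π) t = Ds ρ φ ξ t := by
  unfold Ds pd1
  rw [h1, ← deriv_comp_add_const]
  simp only [h2]

/-- arclength derivative as an honest derivative -/
lemma Sm.hs {T : ℝ} {ρ φ : ℝ → ℝ → ℝ}
    (pos : ∀ ξ t : ℝ, 0 ≤ t → t < T → 0 < ρ ξ t) (h : Sm T φ) {ξ t : ℝ}
    (h0 : 0 < t) (h1 : t < T) :
    HasDerivAt (fun x => φ x t) (_root_.Ds ρ φ ξ t * ρ ξ t) ξ := by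
  have := h.hx (ξ := ξ) h0 h1
  rwa [show _root_.Ds ρ φ ξ t * ρ ξ t = _root_.pd1 φ ξ t from
    div_mul_cancel₀ _ (pos ξ t h0.le h1).ne']

/-- commutator of time and arclength derivatives -/
lemma Sm.comm_s {T : ℝ} {ρ φ : ℝ → ℝ → ℝ} {E : ℝ → ℝ}
    (pos : ∀ ξ t : ℝ, 0 ≤ t → t < T → 0 < ρ ξ t) (h : Sm T φ) {ξ t κ Es : ℝ}
    (h0 : 0 < t) (h1 : t < T)
    (hκ : HasDerivAt (fun τ => ρ ξ τ) (κ * ρ ξ t) t)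
    (hE : ∀ x, HasDerivAt (fun τ => φ x τ) (E x) t)
    (hEs : HasDerivAt E (Es * ρ ξ t) ξ) :
    HasDerivAt (fun τ => _root_.Ds ρ φ ξ τ) (Es - κ * _root_.Ds ρ φ ξ t) t := by
  have hp := (pos ξ t h0.le h1).ne'
  have e1 := h.pd1.ht (ξ := ξ) h0 h1
  rw [h.comm h0 h1] at e1
  have e2 : _root_.pd1 (_root_.pdt φ) ξ t = Es * ρ ξ t := by
    have : (fun x => _root_.pdt φ x t) = E := by
      funext x; exact (hE x).deriv
    unfold _root_.pd1
    rw [this]; exact hEs.deriv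
  rw [e2] at e1
  have e3 := e1.div hκ hp
  refine e3.congr_deriv ?_
  unfold _root_.Ds
  field_simp

/-! Maximum principle. -/

lemma per_bdd {φ : ℝ → ℝ} (hc : Continuous φ) (hp : ∀ ξ, φ (ξ + 2 * π) = φ ξ) :
    ∃ C, 0 < C ∧ ∀ ξ, φ ξ ≤ C := by
  obtain ⟨C, hC⟩ := (isCompact_Icc (a := (0:ℝ)) (b := 0 + 2 * π)).bddAbove_image hc.continuousOn
  refine ⟨max C 1, by positivity, fun ξ => ?_⟩
  have hper : Function.Periodic φ (2 * π) := hp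
  obtain ⟨y, hy, hy2⟩ := hper.exists_mem_Ico₀ Real.two_pi_pos ξ
  rw [hy2]
  exact le_max_of_le_left (hC ⟨y, ⟨hy.1, by linarith [hy.2]⟩, rfl⟩)

lemma second_deriv_max {u u' : ℝ → ℝ} {x₀ c : ℝ} (hmax : ∀ x, u x ≤ u x₀)
    (h1 : ∀ x, HasDerivAt u (u' x) x) (h2 : HasDerivAt u' c x₀) : u' x₀ = 0 ∧ c ≤ 0 := by
  have hz : u' x₀ = 0 :=
    IsLocalMax.hasDerivAt_eq_zero (Filter.Eventually.of_forall hmax) (h1 x₀)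
  refine ⟨hz, ?_⟩
  by_contra hc
  push Not at hc
  have h3 : ∀ᶠ x in 𝓝[>] x₀, 0 < u' x := by
    have := (hasDerivAt_iff_tendsto_slope.1 h2)
    have h4 : ∀ᶠ x in 𝓝[≠] x₀, 0 < slope u' x₀ x := this.eventually (lt_mem_nhds hc)
    have h5 := h4.filter_mono (nhdsWithin_mono x₀ (fun x hx => ne_of_gt hx))
    filter_upwards [h5, self_mem_nhdsWithin] with x hx hx2
    rw [slope_def_field, hz, sub_zero] at hx
    have hx3 : 0 < x - x₀ := sub_pos.2 hx2
    exact (div_pos_iff_of_pos_right hx3).1 hx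
  obtain ⟨b, hb, hb2⟩ := mem_nhdsGT_iff_exists_Ioo_subset.1 h3
  have hb' : x₀ < b := hb
  set m := (x₀ + b) / 2
  have hm : x₀ < m := by simp only [m]; linarith
  have hm2 : m < b := by simp only [m]; linarith
  obtain ⟨y, hy, hy2⟩ := exists_hasDerivAt_eq_slope u u' hm
    (fun x _ => (h1 x).continuousAt.continuousWithinAt) (fun x _ => h1 x)
  have hpos : 0 < u' y := hb2 ⟨hy.1, hy.2.trans hm2⟩
  rw [hy2] at hpos
  have := (div_pos_iff_of_pos_right (sub_pos.2 hm)).1 hpos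
  linarith [hmax m]

lemma left_deriv_max {u : ℝ → ℝ} {a t₀ c : ℝ} (ha : a < t₀)
    (hmax : ∀ t, a ≤ t → t ≤ t₀ → u t ≤ u t₀) (h : HasDerivAt u c t₀) : 0 ≤ c := by
  by_contra hc
  push Not at hc
  have h4 : ∀ᶠ x in 𝓝[≠] t₀, slope u t₀ x < 0 :=
    (hasDerivAt_iff_tendsto_slope.1 h).eventually (gt_mem_nhds hc)
  have h5 : ∀ᶠ x in 𝓝[<] t₀, slope u t₀ x < 0 :=
    h4.filter_mono (nhdsWithin_mono t₀ (fun x hx => ne_of_lt hx))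
  have h6 : ∀ᶠ x in 𝓝[<] t₀, x ∈ Set.Ioo a t₀ := Ioo_mem_nhdsLT ha
  obtain ⟨x, hx, hx2⟩ := (h5.and h6).exists
  rw [slope_def_field] at hx
  have h7 : u x - u t₀ ≤ 0 := by linarith [hmax x hx2.1.le hx2.2.le]
  have h8 : x - t₀ ≤ 0 := by linarith [hx2.2]
  linarith [div_nonneg_of_nonpos h7 h8]

lemma max_principle {T a : ℝ} {ρ Φ Φs Φss Φt : ℝ → ℝ → ℝ}
    (pos : ∀ ξ t : ℝ, a < t → t < T → 0 < ρ ξ t)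
    (per : ∀ ξ t : ℝ, Φ (ξ + 2 * π) t = Φ ξ t)
    (cont : ContinuousOn (fun p : ℝ × ℝ => Φ p.1 p.2) (Set.univ ×ˢ Set.Ico a T))
    (h1 : ∀ ξ t : ℝ, a < t → t < T → HasDerivAt (fun x => Φ x t) (Φs ξ t * ρ ξ t) ξ)
    (h2 : ∀ ξ t : ℝ, a < t → t < T → HasDerivAt (fun x => Φs x t) (Φss ξ t * ρ ξ t) ξ)
    (hρ : ∀ ξ t : ℝ, a < t → t < T → DifferentiableAt ℝ (fun x => ρ x t) ξ)
    (h3 : ∀ ξ t : ℝ, a < t → t < T → HasDerivAt (fun τ => Φ ξ τ) (Φt ξ t) t)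
    (init : ∀ ξ, Φ ξ a ≤ 0)
    (key : ∀ ξ t : ℝ, a < t → t < T → 0 < Φ ξ t → Φs ξ t = 0 → Φss ξ t ≤ 0 → Φt ξ t < 0) :
    ∀ ξ t : ℝ, a ≤ t → t < T → Φ ξ t ≤ 0 := by
  intro ξ₁ t₁ ha hT
  by_contra hcon
  push Not at hcon
  have hcomp : IsCompact ((Set.Icc (0:ℝ) (0 + 2 * π)) ×ˢ Set.Icc a t₁) :=
    isCompact_Icc.prod isCompact_Icc
  have hsub : (Set.Icc (0:ℝ) (0 + 2 * π)) ×ˢ Set.Icc a t₁ ⊆ Set.univ ×ˢ Set.Ico a T := by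
    rintro ⟨x, t⟩ ⟨-, h⟩
    exact ⟨trivial, h.1, lt_of_le_of_lt h.2 hT⟩
  obtain ⟨⟨ξ₀, t₀⟩, ⟨hm1, hm2⟩, hmax⟩ := hcomp.exists_isMaxOn
    ⟨((0:ℝ), a), ⟨⟨le_rfl, by positivity⟩, le_rfl, ha⟩⟩ (cont.mono hsub)
  have hall : ∀ x t, a ≤ t → t ≤ t₁ → Φ x t ≤ Φ ξ₀ t₀ := by
    intro x t hx1 hx2
    have hper : Function.Periodic (fun x => Φ x t) (2 * π) := fun x => per x t
    obtain ⟨y, hy, hy2⟩ := hper.exists_mem_Ico₀ Real.two_pi_pos x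
    have : Φ x t = Φ y t := hy2
    rw [this]
    exact hmax (show ((y, t) : ℝ × ℝ) ∈ _ from ⟨⟨hy.1, by linarith [hy.2]⟩, hx1, hx2⟩)
  simp only at hm2
  have hpos : 0 < Φ ξ₀ t₀ := lt_of_lt_of_le hcon (hall ξ₁ t₁ ha le_rfl)
  have hat : a < t₀ := by
    rcases eq_or_lt_of_le hm2.1 with h | h
    · rw [← h] at hpos; linarith [init ξ₀]
    · exact h
  have htT : t₀ < T := lt_of_le_of_lt hm2.2 hT
  have hr := pos ξ₀ t₀ hat htT
  obtain ⟨d1, d2⟩ := second_deriv_max (fun x => hall x t₀ hm2.1 hm2.2)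
    (fun x => h1 x t₀ hat htT) ((h2 ξ₀ t₀ hat htT).mul (hρ ξ₀ t₀ hat htT).hasDerivAt)
  have e1 : Φs ξ₀ t₀ = 0 := by
    rcases mul_eq_zero.1 d1 with h | h
    · exact h
    · exact absurd h hr.ne'
  have e2 : Φss ξ₀ t₀ ≤ 0 := by
    rw [e1] at d2
    by_contra hh
    push Not at hh
    have : 0 < Φss ξ₀ t₀ * ρ ξ₀ t₀ * ρ ξ₀ t₀ := by positivity
    linarith
  have e3 := key ξ₀ t₀ hat htT hpos e1 e2
  have e4 := left_deriv_max hat (fun t ht1 ht2 => hall ξ₀ t ht1 (ht2.trans hm2.2))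
    (h3 ξ₀ t₀ hat htT)
  linarith

/-! The jet of a solution and its evolution equations. -/

structure Jet (T : ℝ) (f g ρ p q k l k3 l3 k4 : ℝ → ℝ → ℝ) : Prop where
  fpos : ∀ ξ t : ℝ, 0 ≤ t → t < T → 0 < f ξ t
  gpos : ∀ ξ t : ℝ, 0 ≤ t → t < T → 0 < g ξ t
  rpos : ∀ ξ t : ℝ, 0 ≤ t → t < T → 0 < ρ ξ t
  rd : ∀ ξ t : ℝ, 0 < t → t < T → DifferentiableAt ℝ (fun x => ρ x t) ξ
  fper : ∀ ξ t : ℝ, f (ξ + 2 * π) t = f ξ t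
  gper : ∀ ξ t : ℝ, g (ξ + 2 * π) t = g ξ t
  pper : ∀ ξ t : ℝ, p (ξ + 2 * π) t = p ξ t
  qper : ∀ ξ t : ℝ, q (ξ + 2 * π) t = q ξ t
  kper : ∀ ξ t : ℝ, k (ξ + 2 * π) t = k ξ t
  fc : ContinuousOn (fun p : ℝ × ℝ => f p.1 p.2) (Set.univ ×ˢ Set.Ico 0 T)
  gc : ContinuousOn (fun p : ℝ × ℝ => g p.1 p.2) (Set.univ ×ˢ Set.Ico 0 T)
  pc : ContinuousOn (fun z : ℝ × ℝ => p z.1 z.2) (Set.univ ×ˢ Set.Ico 0 T)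
  qc : ∀ a, 0 < a → ContinuousOn (fun p : ℝ × ℝ => q p.1 p.2) (Set.univ ×ˢ Set.Ico a T)
  kc : ∀ a, 0 < a → ContinuousOn (fun p : ℝ × ℝ => k p.1 p.2) (Set.univ ×ˢ Set.Ico a T)
  fs : ∀ ξ t : ℝ, 0 < t → t < T → HasDerivAt (fun x => f x t) (p ξ t * ρ ξ t) ξ
  ps : ∀ ξ t : ℝ, 0 < t → t < T → HasDerivAt (fun x => p x t) (k ξ t * ρ ξ t) ξ
  ks : ∀ ξ t : ℝ, 0 < t → t < T → HasDerivAt (fun x => k x t) (k3 ξ t * ρ ξ t) ξ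
  k3s : ∀ ξ t : ℝ, 0 < t → t < T → HasDerivAt (fun x => k3 x t) (k4 ξ t * ρ ξ t) ξ
  gs : ∀ ξ t : ℝ, 0 < t → t < T → HasDerivAt (fun x => g x t) (q ξ t * ρ ξ t) ξ
  qs : ∀ ξ t : ℝ, 0 < t → t < T → HasDerivAt (fun x => q x t) (l ξ t * ρ ξ t) ξ
  ls : ∀ ξ t : ℝ, 0 < t → t < T → HasDerivAt (fun x => l x t) (l3 ξ t * ρ ξ t) ξ
  ft : ∀ ξ t : ℝ, 0 < t → t < T → HasDerivAt (fun τ => f ξ τ)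
    (k ξ t + 2 * (q ξ t / g ξ t) * p ξ t - 2 * f ξ t ^ 3 / g ξ t ^ 4) t
  gt : ∀ ξ t : ℝ, 0 < t → t < T → HasDerivAt (fun τ => g ξ τ)
    (l ξ t + (p ξ t / f ξ t + q ξ t / g ξ t) * q ξ t
      + 2 * (f ξ t ^ 2 - 2 * g ξ t ^ 2) / g ξ t ^ 3) t
  pt : ∀ ξ t : ℝ, 0 < t → t < T → HasDerivAt (fun τ => p ξ τ)
    (k3 ξ t + (2 * (q ξ t / g ξ t) - p ξ t / f ξ t) * k ξ t
      - (2 * q ξ t ^ 2 / g ξ t ^ 2 + 6 * f ξ t ^ 2 / g ξ t ^ 4) * p ξ t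
      + 8 * f ξ t ^ 3 * q ξ t / g ξ t ^ 5) t
  qt : ∀ ξ t : ℝ, 0 < t → t < T → HasDerivAt (fun τ => q ξ τ)
    (l3 ξ t + p ξ t / f ξ t * l ξ t
      - (p ξ t ^ 2 / f ξ t ^ 2 + q ξ t ^ 2 / g ξ t ^ 2) * q ξ t
      + (4 * g ξ t ^ 2 - 6 * f ξ t ^ 2) * q ξ t / g ξ t ^ 4
      + 4 * f ξ t * p ξ t / g ξ t ^ 3) t
  kt : ∀ ξ t : ℝ, 0 < t → t < T → HasDerivAt (fun τ => k ξ τ)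
    (k4 ξ t + (2 * (q ξ t / g ξ t) - p ξ t / f ξ t) * k3 ξ t
      - 2 * k ξ t ^ 2 / f ξ t
      + k ξ t * (p ξ t ^ 2 / f ξ t ^ 2 - 4 * q ξ t ^ 2 / g ξ t ^ 2 - 6 * f ξ t ^ 2 / g ξ t ^ 4)
      + l ξ t * (8 * f ξ t ^ 3 / g ξ t ^ 5 - 4 * p ξ t * q ξ t / g ξ t ^ 2)
      + 4 * p ξ t * q ξ t ^ 3 / g ξ t ^ 3 - 12 * f ξ t * p ξ t ^ 2 / g ξ t ^ 4
      + 48 * f ξ t ^ 2 * p ξ t * q ξ t / g ξ t ^ 5 - 40 * f ξ t ^ 3 * q ξ t ^ 2 / g ξ t ^ 6) t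

lemma Ds_cont0 {T : ℝ} {f g ρ : ℝ → ℝ → ℝ} (sol : WarpedBerger T f g ρ) :
    ContinuousOn (fun z : ℝ × ℝ => Ds ρ f z.1 z.2) (Set.univ ×ˢ Set.Ico 0 T) := by
  set S : Set (ℝ × ℝ) := Set.univ ×ˢ Set.Ico 0 T with hS
  have hf : ContDiffOn ℝ (⊤ : ℕ∞) (fun p : ℝ × ℝ => f p.1 p.2) S := sol.smooth.fst
  have hρ : ContinuousOn (fun p : ℝ × ℝ => ρ p.1 p.2) S := sol.smooth.snd.snd.continuousOn
  have hu : UniqueDiffOn ℝ S := uniqueDiffOn_univ.prod (uniqueDiffOn_Ico 0 T)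
  have h2 : ContinuousOn (fun z => fderivWithin ℝ (fun p : ℝ × ℝ => f p.1 p.2) S z (1, 0)) S :=
    (hf.continuousOn_fderivWithin hu (by simp)).clm_apply continuousOn_const
  have h3 : ContinuousOn (fun z : ℝ × ℝ => pd1 f z.1 z.2) S := by
    refine h2.congr ?_
    rintro ⟨ξ, t⟩ hz
    have hd := (hf.differentiableOn (by simp) (ξ, t) hz).hasFDerivWithinAt
    have hc : HasDerivWithinAt (fun x : ℝ => (x, t)) ((1 : ℝ), (0 : ℝ)) Set.univ ξ :=
      ((hasDerivAt_id ξ).prodMk (hasDerivAt_const ξ t)).hasDerivWithinAt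
    have := hd.comp_hasDerivWithinAt ξ hc (fun x _ => (⟨trivial, hz.2⟩ : (x, t) ∈ S))
    exact (hasDerivWithinAt_univ.1 this).deriv
  refine h3.div hρ ?_
  rintro ⟨ξ, t⟩ hz
  exact (sol.ρ_pos ξ t hz.2.1 hz.2.2).ne'

lemma jet_of {T : ℝ} {f g ρ : ℝ → ℝ → ℝ} (sol : WarpedBerger T f g ρ) :
    ∃ q l k3 l3 k4 : ℝ → ℝ → ℝ,
      Jet T f g ρ (Ds ρ f) q (Ds ρ (Ds ρ f)) l k3 l3 k4 := by
  have hsub : (Set.univ : Set ℝ) ×ˢ Set.Ioo (0:ℝ) T ⊆ Set.univ ×ˢ Set.Ico 0 T :=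
    Set.prod_mono le_rfl Set.Ioo_subset_Ico_self
  have sf : Sm T f := (sol.smooth.mono hsub).fst
  have sg : Sm T g := (sol.smooth.mono hsub).snd.fst
  have sr : Sm T ρ := (sol.smooth.mono hsub).snd.snd
  have P := sol.ρ_pos
  obtain ⟨p, hp⟩ : ∃ p, p = Ds ρ f := ⟨_, rfl⟩
  obtain ⟨q, hq⟩ : ∃ p, p = Ds ρ g := ⟨_, rfl⟩
  obtain ⟨k, hk⟩ : ∃ k, k = Ds ρ p := ⟨_, rfl⟩
  obtain ⟨l, hl⟩ : ∃ k, k = Ds ρ q := ⟨_, rfl⟩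
  obtain ⟨k3, hk3⟩ : ∃ k3, k3 = Ds ρ k := ⟨_, rfl⟩
  obtain ⟨l3, hl3⟩ : ∃ k3, k3 = Ds ρ l := ⟨_, rfl⟩
  have sp : Sm T p := hp ▸ sr.Ds P sf
  have sq : Sm T q := hq ▸ sr.Ds P sg
  have sk : Sm T k := hk ▸ sr.Ds P sp
  have sl : Sm T l := hl ▸ sr.Ds P sq
  have sk3 : Sm T k3 := hk3 ▸ sr.Ds P sk
  have pper : ∀ ξ t : ℝ, p (ξ + 2 * π) t = p ξ t := hp ▸ Ds_per sol.ρ_per sol.f_per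
  have qper : ∀ ξ t : ℝ, q (ξ + 2 * π) t = q ξ t := hq ▸ Ds_per sol.ρ_per sol.g_per
  have kper : ∀ ξ t : ℝ, k (ξ + 2 * π) t = k ξ t := hk ▸ Ds_per sol.ρ_per pper
  have fs : ∀ ξ t : ℝ, 0 < t → t < T → HasDerivAt (fun x => f x t) (p ξ t * ρ ξ t) ξ :=
    fun ξ t h0 h1 => hp ▸ sf.hs P h0 h1
  have gs : ∀ ξ t : ℝ, 0 < t → t < T → HasDerivAt (fun x => g x t) (q ξ t * ρ ξ t) ξ :=
    fun ξ t h0 h1 => hq ▸ sg.hs P h0 h1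
  have ps : ∀ ξ t : ℝ, 0 < t → t < T → HasDerivAt (fun x => p x t) (k ξ t * ρ ξ t) ξ :=
    fun ξ t h0 h1 => hk ▸ sp.hs P h0 h1
  have qs : ∀ ξ t : ℝ, 0 < t → t < T → HasDerivAt (fun x => q x t) (l ξ t * ρ ξ t) ξ :=
    fun ξ t h0 h1 => hl ▸ sq.hs P h0 h1
  have ks : ∀ ξ t : ℝ, 0 < t → t < T → HasDerivAt (fun x => k x t) (k3 ξ t * ρ ξ t) ξ :=
    fun ξ t h0 h1 => hk3 ▸ sk.hs P h0 h1
  have ls : ∀ ξ t : ℝ, 0 < t → t < T → HasDerivAt (fun x => l x t) (l3 ξ t * ρ ξ t) ξ :=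
    fun ξ t h0 h1 => hl3 ▸ sl.hs P h0 h1
  have ft : ∀ ξ t : ℝ, 0 < t → t < T → HasDerivAt (fun τ => f ξ τ)
      (k ξ t + 2 * (q ξ t / g ξ t) * p ξ t - 2 * f ξ t ^ 3 / g ξ t ^ 4) t := by
    intro ξ t h0 h1
    have := sf.ht (ξ := ξ) h0 h1
    rwa [sol.eq_f ξ t h0 h1, ← hp, ← hk, ← hq] at this
  have gt : ∀ ξ t : ℝ, 0 < t → t < T → HasDerivAt (fun τ => g ξ τ)
      (l ξ t + (p ξ t / f ξ t + q ξ t / g ξ t) * q ξ t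
      + 2 * (f ξ t ^ 2 - 2 * g ξ t ^ 2) / g ξ t ^ 3) t := by
    intro ξ t h0 h1
    have := sg.ht (ξ := ξ) h0 h1
    rwa [sol.eq_g ξ t h0 h1, ← hp, ← hq, ← hl] at this
  have rt : ∀ ξ t : ℝ, 0 < t → t < T → HasDerivAt (fun τ => ρ ξ τ)
      ((k ξ t / f ξ t + 2 * (l ξ t / g ξ t)) * ρ ξ t) t := by
    intro ξ t h0 h1
    have h := sr.ht (ξ := ξ) h0 h1
    have hpos := (P ξ t h0.le h1).ne'
    have h2 : pdt (fun x τ => Real.log (ρ x τ)) ξ t = pdt ρ ξ t / ρ ξ t := (h.log hpos).deriv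
    rw [sol.eq_ρ ξ t h0 h1, ← hp, ← hk, ← hq, ← hl] at h2
    rw [h2, div_mul_cancel₀ _ hpos]
    exact h
  have pt : ∀ ξ t : ℝ, 0 < t → t < T → HasDerivAt (fun τ => p ξ τ)
    (k3 ξ t + (2 * (q ξ t / g ξ t) - p ξ t / f ξ t) * k ξ t
      - (2 * q ξ t ^ 2 / g ξ t ^ 2 + 6 * f ξ t ^ 2 / g ξ t ^ 4) * p ξ t
      + 8 * f ξ t ^ 3 * q ξ t / g ξ t ^ 5) t := by
    intro ξ t h0 h1
    have hf := (sol.f_pos ξ t h0.le h1).ne'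
    have hg := (sol.g_pos ξ t h0.le h1).ne'
    have d := (((ks ξ t h0 h1).add ((((qs ξ t h0 h1).div (gs ξ t h0 h1) hg).const_mul 2).mul
      (ps ξ t h0 h1))).sub ((((fs ξ t h0 h1).pow 3).const_mul 2).div
        ((gs ξ t h0 h1).pow 4) (pow_ne_zero 4 hg)))
    have dE := d.congr_deriv (g' := (k3 ξ t + 2 * (q ξ t / g ξ t) * k ξ t
        + 2 * (l ξ t / g ξ t - q ξ t ^ 2 / g ξ t ^ 2) * p ξ t
        - 6 * f ξ t ^ 2 * p ξ t / g ξ t ^ 4 + 8 * f ξ t ^ 3 * q ξ t / g ξ t ^ 5) * ρ ξ t)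
      (by simp only [Pi.mul_apply, Pi.div_apply, Pi.pow_apply]; push_cast; field_simp; ring)
    have hE := fun x : ℝ => ft x t h0 h1
    have := Sm.comm_s P sf h0 h1 (rt ξ t h0 h1) hE dE
    rw [← hp] at this
    refine this.congr_deriv ?_
    field_simp
    ring
  have qt : ∀ ξ t : ℝ, 0 < t → t < T → HasDerivAt (fun τ => q ξ τ)
    (l3 ξ t + p ξ t / f ξ t * l ξ t
      - (p ξ t ^ 2 / f ξ t ^ 2 + q ξ t ^ 2 / g ξ t ^ 2) * q ξ t
      + (4 * g ξ t ^ 2 - 6 * f ξ t ^ 2) * q ξ t / g ξ t ^ 4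
      + 4 * f ξ t * p ξ t / g ξ t ^ 3) t := by
    intro ξ t h0 h1
    have hf := (sol.f_pos ξ t h0.le h1).ne'
    have hg := (sol.g_pos ξ t h0.le h1).ne'
    have F := fs ξ t h0 h1
    have G := gs ξ t h0 h1
    have d := (((ls ξ t h0 h1).add ((((ps ξ t h0 h1).div F hf).add
      ((qs ξ t h0 h1).div G hg)).mul (qs ξ t h0 h1))).add
      ((((F.pow 2).sub ((G.pow 2).const_mul 2)).const_mul 2).div (G.pow 3) (pow_ne_zero 3 hg)))
    have dE := d.congr_deriv (g' := (l3 ξ t + (p ξ t / f ξ t + q ξ t / g ξ t) * l ξ t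
        + (k ξ t / f ξ t - p ξ t ^ 2 / f ξ t ^ 2 + l ξ t / g ξ t - q ξ t ^ 2 / g ξ t ^ 2) * q ξ t
        + 4 * f ξ t * p ξ t / g ξ t ^ 3 - 6 * f ξ t ^ 2 * q ξ t / g ξ t ^ 4
        + 4 * q ξ t / g ξ t ^ 2) * ρ ξ t)
      (by
        simp only [Pi.mul_apply, Pi.div_apply, Pi.pow_apply, Pi.add_apply, Pi.sub_apply]
        field_simp; ring)
    have hE := fun x : ℝ => gt x t h0 h1
    have := Sm.comm_s P sg h0 h1 (rt ξ t h0 h1) hE dE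
    rw [← hq] at this
    refine this.congr_deriv ?_
    field_simp
    ring
  have kt : ∀ ξ t : ℝ, 0 < t → t < T → HasDerivAt (fun τ => k ξ τ)
    (Ds ρ k3 ξ t + (2 * (q ξ t / g ξ t) - p ξ t / f ξ t) * k3 ξ t
      - 2 * k ξ t ^ 2 / f ξ t
      + k ξ t * (p ξ t ^ 2 / f ξ t ^ 2 - 4 * q ξ t ^ 2 / g ξ t ^ 2 - 6 * f ξ t ^ 2 / g ξ t ^ 4)
      + l ξ t * (8 * f ξ t ^ 3 / g ξ t ^ 5 - 4 * p ξ t * q ξ t / g ξ t ^ 2)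
      + 4 * p ξ t * q ξ t ^ 3 / g ξ t ^ 3 - 12 * f ξ t * p ξ t ^ 2 / g ξ t ^ 4
      + 48 * f ξ t ^ 2 * p ξ t * q ξ t / g ξ t ^ 5
      - 40 * f ξ t ^ 3 * q ξ t ^ 2 / g ξ t ^ 6) t := by
    intro ξ t h0 h1
    have hf := (sol.f_pos ξ t h0.le h1).ne'
    have hg := (sol.g_pos ξ t h0.le h1).ne'
    have F := fs ξ t h0 h1
    have G := gs ξ t h0 h1
    have Pp := ps ξ t h0 h1
    have Q := qs ξ t h0 h1
    have d := ((((sk3.hs P (ξ := ξ) h0 h1).add ((((Q.div G hg).const_mul 2).sub (Pp.div F hf)).mul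
      (ks ξ t h0 h1))).sub (((((Q.pow 2).const_mul 2).div (G.pow 2) (pow_ne_zero 2 hg)).add
      (((F.pow 2).const_mul 6).div (G.pow 4) (pow_ne_zero 4 hg))).mul Pp)).add
      ((((F.pow 3).const_mul 8).mul Q).div (G.pow 5) (pow_ne_zero 5 hg)))
    have dE := d.congr_deriv (g' := (Ds ρ k3 ξ t + (2 * (q ξ t / g ξ t) - p ξ t / f ξ t) * k3 ξ t
        + (2 * l ξ t / g ξ t - 2 * q ξ t ^ 2 / g ξ t ^ 2 - k ξ t / f ξ t
          + p ξ t ^ 2 / f ξ t ^ 2) * k ξ t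
        - (2 * q ξ t ^ 2 / g ξ t ^ 2 + 6 * f ξ t ^ 2 / g ξ t ^ 4) * k ξ t
        - p ξ t * (4 * q ξ t * l ξ t / g ξ t ^ 2 - 4 * q ξ t ^ 3 / g ξ t ^ 3
          + 12 * f ξ t * p ξ t / g ξ t ^ 4 - 24 * f ξ t ^ 2 * q ξ t / g ξ t ^ 5)
        + 24 * f ξ t ^ 2 * p ξ t * q ξ t / g ξ t ^ 5 + 8 * f ξ t ^ 3 * l ξ t / g ξ t ^ 5
        - 40 * f ξ t ^ 3 * q ξ t ^ 2 / g ξ t ^ 6) * ρ ξ t)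
      (by
        simp only [Pi.mul_apply, Pi.div_apply, Pi.pow_apply, Pi.add_apply, Pi.sub_apply]
        field_simp; ring)
    have hE := fun x : ℝ => pt x t h0 h1
    have := Sm.comm_s P sp h0 h1 (rt ξ t h0 h1) hE dE
    rw [← hk] at this
    refine this.congr_deriv ?_
    field_simp
    ring
  refine ⟨q, l, k3, l3, Ds ρ k3, ?_⟩
  have hcp := Ds_cont0 sol
  rw [← hp] at hcp ⊢
  rw [← hk]
  exact
    { fpos := sol.f_pos, gpos := sol.g_pos, rpos := P
      rd := fun ξ t h0 h1 => (sr.hx h0 h1).differentiableAt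
      fper := sol.f_per, gper := sol.g_per, pper := pper, qper := qper, kper := kper
      fc := sol.smooth.continuousOn.fst, gc := sol.smooth.continuousOn.snd.fst, pc := hcp
      qc := fun a ha => sq.cont ha, kc := fun a ha => sk.cont ha
      fs := fs, ps := ps, ks := ks, k3s := fun ξ t h0 h1 => sk3.hs P h0 h1
      gs := gs, qs := qs, ls := ls, ft := ft, gt := gt, pt := pt, qt := qt, kt := kt }

/-! Pointwise algebra at a spatial maximum. -/

lemma key_log {f g p q k l : ℝ} (hf : 0 < f) (hg : 0 < g) (h : p / f - q / g = 0) :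
    (k + 2 * (q / g) * p - 2 * f ^ 3 / g ^ 4) / f
      - (l + (p / f + q / g) * q + 2 * (f ^ 2 - 2 * g ^ 2) / g ^ 3) / g
    = (k / f - p ^ 2 / f ^ 2 - l / g + q ^ 2 / g ^ 2) + 4 * (g ^ 2 - f ^ 2) / g ^ 4 := by
  obtain ⟨b, rfl⟩ : ∃ b, p = f * b := ⟨p / f, by field_simp⟩
  obtain ⟨a, rfl⟩ : ∃ a, q = g * a := ⟨q / g, by field_simp⟩
  have : b = a := by
    rw [mul_div_cancel_left₀ _ hf.ne', mul_div_cancel_left₀ _ hg.ne'] at h; linarith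
  subst this
  field_simp
  ring

lemma key_p {f g p q k k3 : ℝ} (hf : 0 < f) (hg : 0 < g) (hfg : f ≤ g) (hp : 0 < p)
    (hp2 : 4 / 3 < p ^ 2) (hk : k = 0) (hk3 : k3 ≤ 0) :
    k3 + (2 * (q / g) - p / f) * k - (2 * q ^ 2 / g ^ 2 + 6 * f ^ 2 / g ^ 4) * p
      + 8 * f ^ 3 * q / g ^ 5 < 0 := by
  subst hk
  have hx : 0 < f / g := by positivity
  have hx1 : f / g ≤ 1 := (div_le_one hg).2 hfg
  have e : k3 + (2 * (q / g) - p / f) * 0 - (2 * q ^ 2 / g ^ 2 + 6 * f ^ 2 / g ^ 4) * p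
      + 8 * f ^ 3 * q / g ^ 5 = k3 + (1 / g ^ 2) * (-2 * q ^ 2 * p - 6 * (f / g) ^ 2 * p
        + 8 * (f / g) ^ 3 * q) := by
    field_simp
    ring
  rw [e]
  generalize f / g = x at *
  have h4 : x ^ 4 ≤ 1 := pow_le_one₀ hx.le hx1
  have h1 : 0 < p * (2 * q ^ 2 * p + 6 * x ^ 2 * p - 8 * x ^ 3 * q) := by
    nlinarith [sq_nonneg (q * p - 2 * x ^ 3), pow_pos hx 2, mul_pos (pow_pos hx 2) (sub_pos.2 hp2),
      mul_nonneg (pow_pos hx 2).le (sub_nonneg.2 h4)]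
  have h2 : 0 < 2 * q ^ 2 * p + 6 * x ^ 2 * p - 8 * x ^ 3 * q := (pos_iff_pos_of_mul_pos h1).1 hp
  have h3 : 0 < 1 / g ^ 2 := by positivity
  nlinarith [mul_pos h3 h2]

lemma key_q {f g p q l l3 : ℝ} (hf : 0 < f) (hg : 0 < g) (hfg : f ≤ g) (hq : 3 < q)
    (hl : l = 0) (hl3 : l3 ≤ 0) :
    l3 + p / f * l - (p ^ 2 / f ^ 2 + q ^ 2 / g ^ 2) * q + (4 * g ^ 2 - 6 * f ^ 2) * q / g ^ 4
      + 4 * f * p / g ^ 3 < 0 := by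
  subst hl
  have hx : 0 < f / g := by positivity
  have hx1 : f / g ≤ 1 := (div_le_one hg).2 hfg
  obtain ⟨b, rfl⟩ : ∃ b, p = f * b / g := ⟨p * g / f, by field_simp⟩
  have e : l3 + f * b / g / f * 0 - ((f * b / g) ^ 2 / f ^ 2 + q ^ 2 / g ^ 2) * q
      + (4 * g ^ 2 - 6 * f ^ 2) * q / g ^ 4 + 4 * f * (f * b / g) / g ^ 3
      = l3 + (1 / g ^ 2) * (-b ^ 2 * q - q ^ 3 + 4 * q - 6 * (f / g) ^ 2 * q
        + 4 * (f / g) ^ 2 * b) := by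
    field_simp
    ring
  rw [e]
  generalize f / g = x at *
  have h2 : x ^ 2 ≤ 1 := pow_le_one₀ hx.le hx1
  have h2' : 0 < x ^ 2 := by positivity
  have h1 : 0 < b ^ 2 * q + q ^ 3 - 4 * q + 6 * x ^ 2 * q - 4 * x ^ 2 * b := by
    nlinarith [sq_nonneg (b - x ^ 2), mul_pos h2' (show 0 < q by linarith),
      mul_nonneg (sq_nonneg b) (show 0 ≤ q - 3 by linarith),
      mul_pos (show 0 < q by linarith) (show 0 < q ^ 2 - 9 by nlinarith)]
  have h3 : 0 < 1 / g ^ 2 := by positivity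
  nlinarith [mul_pos h3 h1]

lemma gf_alg {x y c p : ℝ} (hx2 : 7 / 10 ≤ x) (hx1 : x ≤ 1) (hc : 0 < c) (hcy : c < y - 1)
    (hp2 : p ^ 2 ≤ 4 / 3) :
    -4 * x ^ 2 * (1 + x) * (y - 1) + c * p ^ 2 - c ^ 2 * p ^ 2 * x + 2 * c * x ^ 4 < 0 := by
  have hx : 0 < x := by linarith
  have hx4 : 0 < x ^ 4 := by positivity
  have h3 : c * (p ^ 2 + 2 * x ^ 4) ≤ (y - 1) * (4 / 3 + 2 * x ^ 4) :=
    mul_le_mul hcy.le (by linarith) (by positivity) (by linarith)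
  have h5 : 49 / 100 ≤ x ^ 2 := by nlinarith
  have h51 : x ^ 2 ≤ 1 := pow_le_one₀ hx.le hx1
  have h6 : x ^ 4 ≤ x ^ 2 := pow_le_pow_of_le_one hx.le hx1 (by norm_num)
  have h61 : 7 / 10 * x ^ 2 ≤ x * x ^ 2 := mul_le_mul_of_nonneg_right hx2 (by positivity)
  have h4 : (0:ℝ) < 4 * x ^ 2 * (1 + x) - (4 / 3 + 2 * x ^ 4) := by
    have : 4 * x ^ 2 * (1 + x) = 4 * x ^ 2 + 4 * (x * x ^ 2) := by ring
    linarith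
  have h7 : 0 < (y - 1) * (4 * x ^ 2 * (1 + x) - (4 / 3 + 2 * x ^ 4)) :=
    mul_pos (by linarith) h4
  have h8 : 0 ≤ c ^ 2 * p ^ 2 * x := by positivity
  linarith

lemma key_gf {f g p q k l C : ℝ} (hf : 0 < f) (hg : 0 < g) (hfg : f ≤ g) (hx0 : 7 / 10 * g ≤ f)
    (hC : 0 < C) (hp2 : p ^ 2 ≤ 4 / 3)
    (h0 : 0 < g / f - 1 - C * f) (h1 : q / f - g * p / f ^ 2 - C * p = 0)
    (h2 : l / f - 2 * q * p / f ^ 2 - g * k / f ^ 2 + 2 * g * p ^ 2 / f ^ 3 - C * k ≤ 0) :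
    (l + (p / f + q / g) * q + 2 * (f ^ 2 - 2 * g ^ 2) / g ^ 3) / f
      - g * (k + 2 * (q / g) * p - 2 * f ^ 3 / g ^ 4) / f ^ 2
      - C * (k + 2 * (q / g) * p - 2 * f ^ 3 / g ^ 4) < 0 := by
  have hq : q = g * p / f + C * f * p := by
    field_simp at h1 ⊢; linarith
  have e : (l + (p / f + q / g) * q + 2 * (f ^ 2 - 2 * g ^ 2) / g ^ 3) / f
      - g * (k + 2 * (q / g) * p - 2 * f ^ 3 / g ^ 4) / f ^ 2
      - C * (k + 2 * (q / g) * p - 2 * f ^ 3 / g ^ 4)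
      = (l / f - 2 * q * p / f ^ 2 - g * k / f ^ 2 + 2 * g * p ^ 2 / f ^ 3 - C * k)
       + (1 / f ^ 2) * (-4 * (f / g) ^ 2 * (1 + f / g) * (g / f - 1) + C * f * p ^ 2
          - (C * f) ^ 2 * p ^ 2 * (f / g) + 2 * (C * f) * (f / g) ^ 4) := by
    subst hq
    field_simp
    ring
  rw [e]
  have hx : 0 < f / g := by positivity
  have hx1 : f / g ≤ 1 := (div_le_one hg).2 hfg
  have hx2 : 7 / 10 ≤ f / g := (le_div_iff₀ hg).2 hx0
  have hCf : 0 < C * f := by positivity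
  have h7 := gf_alg (p := p) hx2 hx1 hCf (by linarith : C * f < g / f - 1) hp2
  have h8 : 0 < 1 / f ^ 2 := by positivity
  have h9 := mul_pos h8 (neg_pos.2 h7)
  rw [mul_neg] at h9
  linarith

/-- evolution of `U = p/f - q/g` -/
lemma U_evol {f g p q k l k3 l3 : ℝ} (hf : 0 < f) (hg : 0 < g) :
    (k3 + (2 * (q / g) - p / f) * k - (2 * q ^ 2 / g ^ 2 + 6 * f ^ 2 / g ^ 4) * p
      + 8 * f ^ 3 * q / g ^ 5) / f
    - p * (k + 2 * (q / g) * p - 2 * f ^ 3 / g ^ 4) / f ^ 2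
    - (l3 + p / f * l - (p ^ 2 / f ^ 2 + q ^ 2 / g ^ 2) * q + (4 * g ^ 2 - 6 * f ^ 2) * q / g ^ 4
      + 4 * f * p / g ^ 3) / g
    + q * (l + (p / f + q / g) * q + 2 * (f ^ 2 - 2 * g ^ 2) / g ^ 3) / g ^ 2
    = (k3 / f - 3 * p * k / f ^ 2 + 2 * p ^ 3 / f ^ 3 - l3 / g + 3 * q * l / g ^ 2
        - 2 * q ^ 3 / g ^ 3)
      + (p / f + 2 * (q / g)) * (k / f - p ^ 2 / f ^ 2 - l / g + q ^ 2 / g ^ 2)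
      - (p ^ 2 / f ^ 2 + 2 * q ^ 2 / g ^ 2 + 8 * f ^ 2 / g ^ 4) * (p / f - q / g)
      - 8 * q / g ^ 3 * (1 - f ^ 2 / g ^ 2) := by
  field_simp
  ring

lemma key_U {f g p q U1 U2 C D G : ℝ} (hf : 0 < f) (hg : 0 < g) (hfg : f ≤ g)
    (hq : |q| ≤ G) (hD : g / f - 1 ≤ D * f) (hD0 : 0 < D) (hG : 0 < G)
    (hC : 2 * G * D ≤ C) (h0 : C < p / f - q / g) (h1 : U1 = 0) (h2 : U2 ≤ 0) :
    U2 + (p / f + 2 * (q / g)) * U1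
      - (p ^ 2 / f ^ 2 + 2 * q ^ 2 / g ^ 2 + 8 * f ^ 2 / g ^ 4) * (p / f - q / g)
      - 8 * q / g ^ 3 * (1 - f ^ 2 / g ^ 2) < 0 := by
  subst h1
  have hU : 0 < p / f - q / g := by
    have : 0 < 2 * G * D := by positivity
    linarith
  set U := p / f - q / g
  have hgf : g - f ≤ D * f ^ 2 := by
    have := mul_le_mul_of_nonneg_right hD hf.le
    field_simp at this
    nlinarith
  have a1 : 0 ≤ (p ^ 2 / f ^ 2 + 2 * q ^ 2 / g ^ 2) * U := by positivity
  have a2 : - (8 * q / g ^ 3 * (1 - f ^ 2 / g ^ 2)) < 8 * f ^ 2 / g ^ 4 * U := by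
    have e1 : - (8 * q / g ^ 3 * (1 - f ^ 2 / g ^ 2)) = (8 / g ^ 5) * (-q * ((g - f) * (g + f))) := by
      field_simp
      ring
    have e2 : 8 * f ^ 2 / g ^ 4 * U = (8 / g ^ 5) * (f ^ 2 * g * U) := by
      field_simp
    rw [e1, e2]
    apply mul_lt_mul_of_pos_left _ (by positivity)
    have b1 : -q * ((g - f) * (g + f)) ≤ G * ((D * f ^ 2) * (2 * g)) := by
      apply mul_le_mul (by linarith [neg_abs_le q]) _ _ hG.le
      · apply mul_le_mul hgf (by linarith) (by linarith) (by positivity)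
      · exact mul_nonneg (by linarith) (by linarith)
    have b2 : 0 < (f ^ 2 * g) * (U - 2 * G * D) := mul_pos (by positivity) (by linarith)
    nlinarith
  nlinarith

set_option maxHeartbeats 1600000 in
lemma key_p1 {f g p q k k3 A C : ℝ} (hf : 0 < f) (hg : 0 < g) (hfg : f ≤ g)
    (hC : 0 < C) (hU : |p / f - q / g| ≤ C) (hA : 5 * C ≤ A) (h0 : 0 < p - 1 - A * f)
    (h1 : k - A * p = 0) (h2 : k3 - A * k ≤ 0) :
    (k3 + (2 * (q / g) - p / f) * k - (2 * q ^ 2 / g ^ 2 + 6 * f ^ 2 / g ^ 4) * p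
      + 8 * f ^ 3 * q / g ^ 5) - A * (k + 2 * (q / g) * p - 2 * f ^ 3 / g ^ 4) < 0 := by
  obtain ⟨U, hUd⟩ : ∃ U, U = p / f - q / g := ⟨_, rfl⟩
  rw [← hUd] at hU
  have hq : q = g * (p / f - U) := by rw [hUd]; field_simp; ring
  have hk : k = A * p := by linarith
  subst hk
  have e : (k3 + (2 * (q / g) - p / f) * (A * p) - (2 * q ^ 2 / g ^ 2 + 6 * f ^ 2 / g ^ 4) * p
      + 8 * f ^ 3 * q / g ^ 5) - A * (A * p + 2 * (q / g) * p - 2 * f ^ 3 / g ^ 4)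
      = (k3 - A * (A * p)) + (1 / f ^ 2) * (-A * p ^ 2 * f + 2 * A * f * (f / g) ^ 4
        - 2 * p * (p - f * U) ^ 2 + 2 * (f / g) ^ 4 * p - 8 * (f / g) ^ 4 * f * U) := by
    rw [hq]
    field_simp
    ring
  rw [e]
  have hx : 0 < f / g := by positivity
  have hx1 : f / g ≤ 1 := (div_le_one hg).2 hfg
  have hx4 : (f / g) ^ 4 ≤ 1 := pow_le_one₀ hx.le hx1
  have hx4' : 0 < (f / g) ^ 4 := by positivity
  generalize (f / g) ^ 4 = z at *
  obtain ⟨hU1, hU2⟩ := abs_le.1 hU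
  have hA0 : 0 < A := by linarith
  have hp : 1 < p := by nlinarith [mul_pos hA0 hf]
  have a1 : 2 * A * f * z ≤ 2 * A * f := by nlinarith [mul_pos hA0 hf]
  have a2 : 2 * z * p ≤ 2 * p := by nlinarith
  have a3 : -8 * z * f * U ≤ 8 * f * C := by
    have : -(z * U) ≤ 1 * C := by nlinarith
    nlinarith
  have a4 : -2 * p * (p - f * U) ^ 2 ≤ -2 * p ^ 3 + 4 * p ^ 2 * f * C := by
    nlinarith [mul_nonneg (show 0 ≤ p by linarith) (sq_nonneg (f * U)),
      mul_nonneg (mul_nonneg (sq_nonneg p) hf.le) (show 0 ≤ C - U by linarith)]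
  have a5 : -2 * p * (p ^ 2 - 1) ≤ -2 * p * ((p + 1) * (A * f)) := by
    have : 0 ≤ p * ((p - 1 - A * f) * (p + 1)) :=
      mul_nonneg (by linarith) (mul_nonneg h0.le (by linarith))
    linarith
  have a6 : 0 < f * (3 * A * p ^ 2 - 2 * A + 2 * p * A - 4 * p ^ 2 * C - 8 * C) := by
    apply mul_pos hf
    have hp2 : 1 < p ^ 2 := by nlinarith
    have b1 : 0 ≤ (A - 5 * C) * (3 * p ^ 2 + 2 * p - 2) :=
      mul_nonneg (by linarith) (by linarith)
    have b2 : 0 < C * (11 * p ^ 2 + 10 * p - 18) := mul_pos hC (by linarith)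
    linarith
  have a7 : -A * p ^ 2 * f + 2 * A * f * z - 2 * p * (p - f * U) ^ 2 + 2 * z * p
      - 8 * z * f * U < 0 := by linarith
  have h8 : 0 < 1 / f ^ 2 := by positivity
  have h9 := mul_pos h8 (neg_pos.2 a7)
  rw [mul_neg] at h9
  linarith

lemma Y_ident {f g p q k l k3 k4 L U1 U2 : ℝ} (hf : 0 < f) (hg : 0 < g) (hL : 0 < L)
    (hU1 : U1 = k / f - p ^ 2 / f ^ 2 - l / g + q ^ 2 / g ^ 2) :
    (L - 1) * (k + 2 * (q / g) * p - 2 * f ^ 3 / g ^ 4) * k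
     + L * f * (k4 + (2 * (q / g) - p / f) * k3 - 2 * k ^ 2 / f
      + k * (p ^ 2 / f ^ 2 - 4 * q ^ 2 / g ^ 2 - 6 * f ^ 2 / g ^ 4)
      + l * (8 * f ^ 3 / g ^ 5 - 4 * p * q / g ^ 2)
      + 4 * p * q ^ 3 / g ^ 3 - 12 * f * p ^ 2 / g ^ 4
      + 48 * f ^ 2 * p * q / g ^ 5 - 40 * f ^ 3 * q ^ 2 / g ^ 6)
     + (k + 2 * (q / g) * p - 2 * f ^ 3 / g ^ 4) * (p / f - q / g) ^ 2
     + 2 * f * (p / f - q / g) * (U2 + (p / f + 2 * (q / g)) * U1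
      - (p ^ 2 / f ^ 2 + 2 * q ^ 2 / g ^ 2 + 8 * f ^ 2 / g ^ 4) * (p / f - q / g)
      - 8 * q / g ^ 3 * (1 - f ^ 2 / g ^ 2))
    = (((L - 1) * k - p ^ 2 / f) * k + 2 * (L - 1) * p * k3 + L * f * k4
       + k * (p / f - q / g) ^ 2 + 4 * p * (p / f - q / g) * U1 + 2 * f * U1 ^ 2
       + 2 * f * (p / f - q / g) * U2)
      + (2 * (q / g) - 3 * p / f + 2 * p / (L * f)) * ((L - 1) * p * k + L * f * k3
        + p * (p / f - q / g) ^ 2 + 2 * f * (p / f - q / g) * U1)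
      + (1 / f ^ 2) * (
        L * (-2 * (f * k) ^ 2
          + (f * k) * (-4 * p ^ 2 + 12 * p * (f * (p / f - q / g)) - 4 * (f * (p / f - q / g)) ^ 2)
          - (f ^ 2 * U1) * (8 * (f ^ 2 / g ^ 2) ^ 2 - 4 * p * (p - f * (p / f - q / g)))
          + 4 * p ^ 4 - 4 * p ^ 3 * (f * (p / f - q / g))
          + (f ^ 2 / g ^ 2) ^ 2 * (-4 * p ^ 2 + 16 * p * (f * (p / f - q / g))
            - 32 * (f * (p / f - q / g)) ^ 2))
        + (f * k) * (-4 * p ^ 2 + 2 * (f ^ 2 / g ^ 2) ^ 2 + 2 * p ^ 2 / L)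
        + f * ((p / f - q / g) ^ 2 * (3 * p ^ 2 - 2 * (f ^ 2 / g ^ 2) ^ 2 - 2 * p ^ 2 / L)
          - 2 * (p ^ 2 + 2 * (p - f * (p / f - q / g)) ^ 2 + 8 * (f ^ 2 / g ^ 2) ^ 2)
            * (p / f - q / g) ^ 2)
        - 16 * (p / f - q / g) * (p - f * (p / f - q / g)) * (f ^ 2 / g ^ 2) * (1 - f ^ 2 / g ^ 2)
        - 2 * (f ^ 2 * U1) ^ 2 / f
        + 4 * p * (p / f - q / g) * (f ^ 2 * U1) * (1 - 1 / L)) := by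
  obtain ⟨U, hUd⟩ : ∃ U, U = p / f - q / g := ⟨_, rfl⟩
  have hq : q = g * (p / f - U) := by rw [hUd]; field_simp; ring
  have hl : l = g * (k / f - p ^ 2 / f ^ 2 + q ^ 2 / g ^ 2 - U1) := by
    rw [hU1]; field_simp; ring
  rw [← hUd]
  clear hU1 hUd
  rw [hl, hq]
  clear hl hq
  field_simp
  ring

set_option maxHeartbeats 1600000 in
lemma Y_alg {f L K V U p e c : ℝ} (hf : 0 < f) (hfc : f ≤ c) (hc : 1 ≤ c) (hU : |U| ≤ c)
    (he : 0 < e) (he1 : e ≤ 1) (hd : 1 - e ≤ c * f) (hp2 : p ^ 2 ≤ 1 + c * f) (hp : |p| ≤ 2)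
    (hL : 1 ≤ L) (hLf : L ^ 3 * f ≤ c) (hK : 50 * c ^ 3 ≤ L * K) :
    L * (-2 * K ^ 2
          + K * (-4 * p ^ 2 + 12 * p * (f * U) - 4 * (f * U) ^ 2)
          - V * (8 * e ^ 2 - 4 * p * (p - f * U))
          + 4 * p ^ 4 - 4 * p ^ 3 * (f * U)
          + e ^ 2 * (-4 * p ^ 2 + 16 * p * (f * U) - 32 * (f * U) ^ 2))
        + K * (-4 * p ^ 2 + 2 * e ^ 2 + 2 * p ^ 2 / L)
        + f * (U ^ 2 * (3 * p ^ 2 - 2 * e ^ 2 - 2 * p ^ 2 / L)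
          - 2 * (p ^ 2 + 2 * (p - f * U) ^ 2 + 8 * e ^ 2) * U ^ 2)
        - 16 * U * (p - f * U) * e * (1 - e)
        - 2 * V ^ 2 / f
        + 4 * p * U * V * (1 - 1 / L) < 0 := by
  have hc0 : 0 < c := by linarith
  have hL0 : 0 < L := by linarith
  have hK0 : 0 < K := by
    have : 0 < L * K := lt_of_lt_of_le (by positivity) hK
    exact (pos_iff_pos_of_mul_pos this).1 hL0
  have hp4 : p ^ 2 ≤ 4 := by rw [← sq_abs]; nlinarith [abs_nonneg p]
  have hc2 : 1 ≤ c ^ 2 := one_le_pow₀ hc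
  have he2 : e ^ 2 ≤ 1 := pow_le_one₀ he.le he1
  have he2' : 0 ≤ e ^ 2 := by positivity
  have hW : |f * U| ≤ c * f := by
    rw [abs_mul, abs_of_pos hf, mul_comm c f]
    exact mul_le_mul_of_nonneg_left hU hf.le
  have hWc : |f * U| ≤ c ^ 2 := hW.trans (by nlinarith)
  generalize hWd : f * U = W at *
  have hpW : |p * W| ≤ 2 * (c * f) := by
    rw [abs_mul]; exact mul_le_mul hp hW (abs_nonneg _) (by norm_num)
  have hcf : 0 < c * f := by positivity
  have hpW1 := (abs_le.1 hpW).1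
  have hpW2 := (abs_le.1 hpW).2
  have hLf1 : L * f ≤ c := by
    have : L * f ≤ L ^ 3 * f := by
      apply mul_le_mul_of_nonneg_right _ hf.le
      calc L = L ^ 1 := by ring
        _ ≤ L ^ 3 := pow_le_pow_right₀ hL (by norm_num)
    linarith
  have hpmW : |p - W| ≤ 3 * c ^ 2 := by
    have := abs_sub p W
    linarith
  have b1 : K * (-4 * p ^ 2 + 12 * p * W - 4 * W ^ 2) ≤ K * (24 * (c * f)) := by
    apply mul_le_mul_of_nonneg_left _ hK0.le
    nlinarith [sq_nonneg p, sq_nonneg W]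
  have b1' : L * (K * (24 * (c * f))) ≤ 24 * c ^ 2 * K := by
    have : (24 * c * K) * (L * f) ≤ (24 * c * K) * c :=
      mul_le_mul_of_nonneg_left hLf1 (by positivity)
    linarith
  have hpL : p ^ 2 / L ≤ p ^ 2 := div_le_self (sq_nonneg p) hL
  have hpL0 : 0 ≤ p ^ 2 / L := by positivity
  have b2 : K * (-4 * p ^ 2 + 2 * e ^ 2 + 2 * p ^ 2 / L) ≤ K * (2 * c ^ 2) := by
    apply mul_le_mul_of_nonneg_left _ hK0.le
    rw [mul_div_assoc]
    linarith [sq_nonneg p]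
  have b3 : 4 * p ^ 4 - 4 * p ^ 3 * W + e ^ 2 * (-4 * p ^ 2 + 16 * p * W - 32 * W ^ 2)
      ≤ 112 * (c * f) := by
    have d1 : p ^ 2 * (p ^ 2 - e ^ 2) ≤ p ^ 2 * (3 * (c * f)) := by
      apply mul_le_mul_of_nonneg_left _ (sq_nonneg p)
      nlinarith
    have d2 : p ^ 2 * (3 * (c * f)) ≤ 4 * (3 * (c * f)) :=
      mul_le_mul_of_nonneg_right hp4 (by positivity)
    have d3 : p ^ 2 * (-(p * W)) ≤ 4 * (2 * (c * f)) := by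
      rcases le_total 0 (-(p * W)) with h0 | h0
      · exact mul_le_mul hp4 (by linarith) h0 (by norm_num)
      · have := mul_nonpos_of_nonneg_of_nonpos (sq_nonneg p) h0
        linarith
    have d4 : e ^ 2 * (p * W) ≤ 1 * (2 * (c * f)) := by
      rcases le_total 0 (p * W) with h0 | h0
      · exact mul_le_mul he2 hpW2 h0 (by norm_num)
      · have := mul_nonpos_of_nonneg_of_nonpos he2' h0
        linarith
    have d5 : 0 ≤ e ^ 2 * W ^ 2 := by positivity
    linarith
  have b4 : -(V * (8 * e ^ 2 - 4 * p * (p - W))) ≤ |V| * (32 * c ^ 2) := by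
    refine (neg_le_abs _).trans ?_
    rw [abs_mul]
    apply mul_le_mul_of_nonneg_left _ (abs_nonneg _)
    have d1 : |p * (p - W)| ≤ 2 * (3 * c ^ 2) := by
      rw [abs_mul]; exact mul_le_mul hp hpmW (abs_nonneg _) (by norm_num)
    rw [abs_le] at d1 ⊢
    constructor <;> linarith [d1.1, d1.2]
  have hU2 : U ^ 2 ≤ c ^ 2 := by rw [← sq_abs]; exact pow_le_pow_left₀ (abs_nonneg _) hU 2
  have b5 : f * (U ^ 2 * (3 * p ^ 2 - 2 * e ^ 2 - 2 * p ^ 2 / L)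
          - 2 * (p ^ 2 + 2 * (p - W) ^ 2 + 8 * e ^ 2) * U ^ 2) ≤ f * (4 * c ^ 2) := by
    apply mul_le_mul_of_nonneg_left _ hf.le
    have d1 : U ^ 2 * p ^ 2 ≤ c ^ 2 * 4 := mul_le_mul hU2 hp4 (sq_nonneg _) (by positivity)
    have d2 : 0 ≤ U ^ 2 * (p ^ 2 / L) := by positivity
    have d3 : 0 ≤ U ^ 2 * (p - W) ^ 2 := by positivity
    have d4 : 0 ≤ U ^ 2 * e ^ 2 := by positivity
    rw [mul_div_assoc]
    linarith
  have b6 : -(16 * U * (p - W) * e * (1 - e)) ≤ 48 * c ^ 4 * f := by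
    have d1 : |U * (p - W)| ≤ c * (3 * c ^ 2) := by
      rw [abs_mul]; exact mul_le_mul hU hpmW (abs_nonneg _) hc0.le
    have d2 : e * (1 - e) ≤ 1 * (c * f) := mul_le_mul he1 hd (by linarith) (by norm_num)
    have d3 : 0 ≤ e * (1 - e) := mul_nonneg he.le (by linarith)
    have d4 : |U * (p - W)| * (e * (1 - e)) ≤ c * (3 * c ^ 2) * (1 * (c * f)) :=
      mul_le_mul d1 d2 d3 (by positivity)
    have d5 : -(U * (p - W)) * (e * (1 - e)) ≤ |U * (p - W)| * (e * (1 - e)) :=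
      mul_le_mul_of_nonneg_right (neg_le_abs _) d3
    linarith
  have b7 : 4 * p * U * V * (1 - 1 / L) ≤ 8 * c * |V| := by
    have d0 : 1 / L ≤ 1 := (div_le_one hL0).2 hL
    have d1 : 0 < 1 / L := by positivity
    have d2 : |p * U| ≤ 2 * c := by
      rw [abs_mul]; exact mul_le_mul hp hU (abs_nonneg _) (by norm_num)
    have d3 : |p * U * V| ≤ 2 * c * |V| := by
      rw [abs_mul]; exact mul_le_mul_of_nonneg_right d2 (abs_nonneg _)
    have d4 : (p * U * V) * (1 - 1 / L) ≤ |p * U * V| * (1 - 1 / L) :=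
      mul_le_mul_of_nonneg_right (le_abs_self _) (by linarith)
    have d5 : |p * U * V| * (1 - 1 / L) ≤ |p * U * V| * 1 :=
      mul_le_mul_of_nonneg_left (by linarith) (abs_nonneg _)
    linarith
  have b8 : 40 * c ^ 2 * L * |V| ≤ V ^ 2 / f + 400 * c ^ 4 * L ^ 2 * f := by
    have : 0 ≤ (|V| - 20 * c ^ 2 * L * f) ^ 2 / f := by positivity
    have e1 : (|V| - 20 * c ^ 2 * L * f) ^ 2 / f
        = V ^ 2 / f - 40 * c ^ 2 * L * |V| + 400 * c ^ 4 * L ^ 2 * f := by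
      rw [← sq_abs V]
      field_simp
      ring
    linarith
  have b9 : 0 ≤ V ^ 2 / f := by positivity
  have b4' := mul_le_mul_of_nonneg_left b4 hL0.le
  have b3' := mul_le_mul_of_nonneg_left b3 hL0.le
  have b1'' := mul_le_mul_of_nonneg_left b1 hL0.le
  have b10 : 8 * c * |V| ≤ 8 * c ^ 2 * L * |V| := by
    apply mul_le_mul_of_nonneg_right _ (abs_nonneg _)
    have : c * 1 ≤ c * (c * L) := mul_le_mul_of_nonneg_left (by nlinarith) hc0.le
    linarith
  have hc4 : c ≤ c ^ 4 := le_self_pow₀ hc (by norm_num)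
  have hc24 : c ^ 2 ≤ c ^ 4 := pow_le_pow_right₀ hc (by norm_num)
  have hL2 : L ≤ L ^ 2 := le_self_pow₀ hL (by norm_num)
  have hL21 : 1 ≤ L ^ 2 := one_le_pow₀ hL
  have b11 : 112 * (L * c * f) ≤ 112 * (c ^ 4 * L ^ 2 * f) := by
    have : L * c ≤ L ^ 2 * c ^ 4 := mul_le_mul hL2 hc4 hc0.le (by positivity)
    have := mul_le_mul_of_nonneg_right this hf.le
    linarith
  have b12 : 4 * c ^ 2 * f + 48 * c ^ 4 * f ≤ 60 * (c ^ 4 * L ^ 2 * f) := by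
    have d1 : c ^ 4 * 1 ≤ c ^ 4 * L ^ 2 := mul_le_mul_of_nonneg_left hL21 (by positivity)
    have d2 := mul_le_mul_of_nonneg_right d1 hf.le
    have d3 := mul_le_mul_of_nonneg_right hc24 hf.le
    have d4 : 0 < c ^ 4 * f := by positivity
    linarith
  have fin : -2 * L * K ^ 2 + 26 * c ^ 2 * K + 572 * (c ^ 4 * L ^ 2 * f) < 0 := by
    have d0 : L * (-2 * L * K ^ 2 + 26 * c ^ 2 * K + 572 * (c ^ 4 * L ^ 2 * f)) < 0 := by
      have d1 : c ^ 4 * (L ^ 3 * f) ≤ c ^ 4 * c := mul_le_mul_of_nonneg_left hLf (by positivity)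
      have d2 : (50 * c ^ 3) * (L * K) ≤ (L * K) * (L * K) :=
        mul_le_mul_of_nonneg_right hK (by positivity)
      have d3 : c ^ 2 * (L * K) ≤ c ^ 3 * (L * K) :=
        mul_le_mul_of_nonneg_right (pow_le_pow_right₀ hc (by norm_num)) (by positivity)
      have d4 : c ^ 3 * (50 * c ^ 3) ≤ c ^ 3 * (L * K) :=
        mul_le_mul_of_nonneg_left hK (by positivity)
      have d5 : c ^ 5 ≤ c ^ 6 := pow_le_pow_right₀ hc (by norm_num)
      have d6 : 0 < c ^ 6 := by positivity
      have e5 : c ^ 4 * c = c ^ 5 := by ring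
      have e6 : c ^ 3 * (50 * c ^ 3) = 50 * c ^ 6 := by ring
      linarith
    by_contra hcon
    exact absurd (mul_nonneg hL0.le (not_lt.1 hcon)) (not_le.2 d0)
  rw [mul_div_assoc 2 (V ^ 2) f]
  linarith

lemma key_Y {f g p q k l k3 k4 L U1 U2 c : ℝ} (hf : 0 < f) (hg : 0 < g) (hfg : f ≤ g)
    (hU1 : U1 = k / f - p ^ 2 / f ^ 2 - l / g + q ^ 2 / g ^ 2)
    (hfc : f ≤ c) (hc : 1 ≤ c) (hU : |p / f - q / g| ≤ c)
    (hd : 1 - f ^ 2 / g ^ 2 ≤ c * f) (hp2 : p ^ 2 ≤ 1 + c * f) (hp : |p| ≤ 2)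
    (hL : 1 ≤ L) (hLf : L ^ 3 * f ≤ c)
    (h0 : 51 * c ^ 3 < L * f * k + f * (p / f - q / g) ^ 2)
    (h1 : (L - 1) * p * k + L * f * k3
        + p * (p / f - q / g) ^ 2 + 2 * f * (p / f - q / g) * U1 = 0)
    (h2 : ((L - 1) * k - p ^ 2 / f) * k + 2 * (L - 1) * p * k3 + L * f * k4
       + k * (p / f - q / g) ^ 2 + 4 * p * (p / f - q / g) * U1 + 2 * f * U1 ^ 2
       + 2 * f * (p / f - q / g) * U2 ≤ 0) :
    (L - 1) * (k + 2 * (q / g) * p - 2 * f ^ 3 / g ^ 4) * k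
     + L * f * (k4 + (2 * (q / g) - p / f) * k3 - 2 * k ^ 2 / f
      + k * (p ^ 2 / f ^ 2 - 4 * q ^ 2 / g ^ 2 - 6 * f ^ 2 / g ^ 4)
      + l * (8 * f ^ 3 / g ^ 5 - 4 * p * q / g ^ 2)
      + 4 * p * q ^ 3 / g ^ 3 - 12 * f * p ^ 2 / g ^ 4
      + 48 * f ^ 2 * p * q / g ^ 5 - 40 * f ^ 3 * q ^ 2 / g ^ 6)
     + (k + 2 * (q / g) * p - 2 * f ^ 3 / g ^ 4) * (p / f - q / g) ^ 2
     + 2 * f * (p / f - q / g) * (U2 + (p / f + 2 * (q / g)) * U1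
      - (p ^ 2 / f ^ 2 + 2 * q ^ 2 / g ^ 2 + 8 * f ^ 2 / g ^ 4) * (p / f - q / g)
      - 8 * q / g ^ 3 * (1 - f ^ 2 / g ^ 2)) < 0 := by
  rw [Y_ident hf hg (by linarith : 0 < L) hU1, h1, mul_zero, add_zero]
  have hK : 50 * c ^ 3 ≤ L * (f * k) := by
    have hU2 : (p / f - q / g) ^ 2 ≤ c ^ 2 := by
      rw [← sq_abs]; exact pow_le_pow_left₀ (abs_nonneg _) hU 2
    have : f * (p / f - q / g) ^ 2 ≤ c * c ^ 2 := mul_le_mul hfc hU2 (sq_nonneg _) (by linarith)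
    have e : c * c ^ 2 = c ^ 3 := by ring
    linarith
  have he1 : f ^ 2 / g ^ 2 ≤ 1 := by
    rw [div_le_one (by positivity)]; exact pow_le_pow_left₀ hf.le hfg 2
  have key := Y_alg (V := f ^ 2 * U1) hf hfc hc hU (by positivity : 0 < f ^ 2 / g ^ 2)
    he1 hd hp2 hp hL hLf hK
  have h8 : 0 < 1 / f ^ 2 := by positivity
  have h9 := mul_pos h8 (neg_pos.2 key)
  rw [mul_neg] at h9
  linarith

/-! Global estimates. -/

lemma slice_cont {Φ : ℝ → ℝ → ℝ} {a T t : ℝ}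
    (h : ContinuousOn (fun z : ℝ × ℝ => Φ z.1 z.2) (univ ×ˢ Ico a T)) (h1 : a ≤ t) (h2 : t < T) :
    Continuous (fun x => Φ x t) := by
  have h3 : ContinuousOn (fun x : ℝ => (x, t)) univ := by fun_prop
  have := h.comp h3 (fun x _ => (⟨trivial, h1, h2⟩ : (x, t) ∈ univ ×ˢ Ico a T))
  exact continuousOn_univ.1 this

lemma cont_mono {Φ : ℝ → ℝ → ℝ} {a b T : ℝ} (hab : a ≤ b)
    (h : ContinuousOn (fun z : ℝ × ℝ => Φ z.1 z.2) (univ ×ˢ Ico a T)) :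
    ContinuousOn (fun z : ℝ × ℝ => Φ z.1 z.2) (univ ×ˢ Ico b T) :=
  h.mono (fun _ hz => ⟨trivial, hab.trans hz.2.1, hz.2.2⟩)

lemma stepA {T : ℝ} {f g ρ p q k l k3 l3 k4 : ℝ → ℝ → ℝ} (hT : 0 < T)
    (J : Jet T f g ρ p q k l k3 l3 k4) :
    ∃ F, 0 < F ∧ ∀ ξ t, 0 ≤ t → t < T → f ξ t ≤ F := by
  obtain ⟨F, hF, hb⟩ := per_bdd (slice_cont J.fc le_rfl hT) (fun ξ => J.fper ξ 0)
  refine ⟨F, hF, fun ξ t h0 h1 => ?_⟩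
  have := max_principle (T := T) (a := 0) (ρ := ρ) (Φ := fun ξ t => f ξ t - F) (Φs := p) (Φss := k)
    (Φt := fun ξ t => k ξ t + 2 * (q ξ t / g ξ t) * p ξ t - 2 * f ξ t ^ 3 / g ξ t ^ 4)
    (fun ξ t h0 h1 => J.rpos ξ t h0.le h1) (fun ξ t => by simp only [J.fper])
    (J.fc.sub continuousOn_const)
    (fun ξ t h0 h1 => (J.fs ξ t h0 h1).sub_const F) J.ps J.rd
    (fun ξ t h0 h1 => (J.ft ξ t h0 h1).sub_const F) (fun ξ => sub_nonpos.2 (hb ξ))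
    (by
      intro ξ t h0 h1 _ hp hk
      have hf := J.fpos ξ t h0.le h1
      have hg := J.gpos ξ t h0.le h1
      have : 0 < 2 * f ξ t ^ 3 / g ξ t ^ 4 := by positivity
      simp only [hp, mul_zero]
      linarith) ξ t h0 h1
  exact sub_nonpos.1 this

/-- derivatives of `log f - log g` -/
lemma log_deriv {f g : ℝ → ℝ} {f' g' x : ℝ} (hf : 0 < f x) (hg : 0 < g x)
    (h1 : HasDerivAt f f' x) (h2 : HasDerivAt g g' x) :
    HasDerivAt (fun x => Real.log (f x) - Real.log (g x)) (f' / f x - g' / g x) x :=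
  (h1.log hf.ne').sub (h2.log hg.ne')

lemma U_deriv {f g p q : ℝ → ℝ} {x f' g' p' q' : ℝ} (hf : 0 < f x) (hg : 0 < g x)
    (h1 : HasDerivAt f f' x) (h2 : HasDerivAt g g' x)
    (h3 : HasDerivAt p p' x) (h4 : HasDerivAt q q' x) :
    HasDerivAt (fun x => p x / f x - q x / g x)
      (p' / f x - p x * f' / f x ^ 2 - q' / g x + q x * g' / g x ^ 2) x := by
  refine ((h3.div h1 hf.ne').sub (h4.div h2 hg.ne')).congr_deriv ?_
  field_simp
  ring

lemma stepB {T : ℝ} {f g ρ p q k l k3 l3 k4 : ℝ → ℝ → ℝ}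
    (J : Jet T f g ρ p q k l k3 l3 k4) (hi : ∀ ξ, f ξ 0 ≤ g ξ 0) (hT : 0 < T) :
    ∀ ξ t, 0 ≤ t → t < T → f ξ t ≤ g ξ t := by
  intro ξ t h0 h1
  have := max_principle (T := T) (a := 0) (ρ := ρ)
    (Φ := fun ξ t => Real.log (f ξ t) - Real.log (g ξ t))
    (Φs := fun ξ t => p ξ t / f ξ t - q ξ t / g ξ t)
    (Φss := fun ξ t => k ξ t / f ξ t - p ξ t ^ 2 / f ξ t ^ 2 - l ξ t / g ξ t
      + q ξ t ^ 2 / g ξ t ^ 2)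
    (Φt := fun ξ t => (k ξ t + 2 * (q ξ t / g ξ t) * p ξ t - 2 * f ξ t ^ 3 / g ξ t ^ 4) / f ξ t
      - (l ξ t + (p ξ t / f ξ t + q ξ t / g ξ t) * q ξ t
      + 2 * (f ξ t ^ 2 - 2 * g ξ t ^ 2) / g ξ t ^ 3) / g ξ t)
    (fun ξ t h0 h1 => J.rpos ξ t h0.le h1) (fun ξ t => by simp only [J.fper, J.gper])
    (by
      refine (J.fc.log ?_).sub (J.gc.log ?_)
      · intro z hz; exact (J.fpos _ _ hz.2.1 hz.2.2).ne'
      · intro z hz; exact (J.gpos _ _ hz.2.1 hz.2.2).ne')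
    (fun ξ t h0 h1 => (log_deriv (f := fun x => f x t) (g := fun x => g x t) (J.fpos ξ t h0.le h1) (J.gpos ξ t h0.le h1)
      (J.fs ξ t h0 h1) (J.gs ξ t h0 h1)).congr_deriv (by ring))
    (fun ξ t h0 h1 => (U_deriv (f := fun x => f x t) (g := fun x => g x t)
      (p := fun x => p x t) (q := fun x => q x t) (J.fpos ξ t h0.le h1) (J.gpos ξ t h0.le h1)
      (J.fs ξ t h0 h1) (J.gs ξ t h0 h1) (J.ps ξ t h0 h1) (J.qs ξ t h0 h1)).congr_deriv (by ring))
    J.rd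
    (fun ξ t h0 h1 => log_deriv (f := fun τ => f ξ τ) (g := fun τ => g ξ τ)
      (J.fpos ξ t h0.le h1) (J.gpos ξ t h0.le h1) (J.ft ξ t h0 h1) (J.gt ξ t h0 h1))
    (fun ξ => sub_nonpos.2 (Real.log_le_log (J.fpos ξ 0 le_rfl hT) (hi ξ)))
    (by
      intro ξ t h0 h1 hpos hs hss
      have hf := J.fpos ξ t h0.le h1
      have hg := J.gpos ξ t h0.le h1
      have hlt : g ξ t < f ξ t := (Real.log_lt_log_iff hg hf).1 (sub_pos.1 hpos)
      have hsq : g ξ t ^ 2 < f ξ t ^ 2 := pow_lt_pow_left₀ hlt hg.le (by norm_num)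
      have h3 : 4 * (g ξ t ^ 2 - f ξ t ^ 2) / g ξ t ^ 4 < 0 :=
        div_neg_of_neg_of_pos (by linarith) (by positivity)
      have := key_log (k := k ξ t) (l := l ξ t) hf hg hs
      linarith) ξ t h0 h1
  exact (Real.log_le_log_iff (J.fpos ξ t h0 h1) (J.gpos ξ t h0 h1)).1 (sub_nonpos.1 this)

lemma stepC {T x0 : ℝ} {f g ρ p q k l k3 l3 k4 : ℝ → ℝ → ℝ}
    (J : Jet T f g ρ p q k l k3 l3 k4) (hx : 0 < x0) (hx1 : x0 < 1)
    (hi : ∀ ξ, x0 * g ξ 0 ≤ f ξ 0) (hT : 0 < T) :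
    ∀ ξ t, 0 ≤ t → t < T → x0 * g ξ t ≤ f ξ t := by
  intro ξ t h0 h1
  have := max_principle (T := T) (a := 0) (ρ := ρ)
    (Φ := fun ξ t => Real.log x0 - (Real.log (f ξ t) - Real.log (g ξ t)))
    (Φs := fun ξ t => -(p ξ t / f ξ t - q ξ t / g ξ t))
    (Φss := fun ξ t => -(k ξ t / f ξ t - p ξ t ^ 2 / f ξ t ^ 2 - l ξ t / g ξ t
      + q ξ t ^ 2 / g ξ t ^ 2))
    (Φt := fun ξ t => -((k ξ t + 2 * (q ξ t / g ξ t) * p ξ t - 2 * f ξ t ^ 3 / g ξ t ^ 4) / f ξ t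
      - (l ξ t + (p ξ t / f ξ t + q ξ t / g ξ t) * q ξ t
      + 2 * (f ξ t ^ 2 - 2 * g ξ t ^ 2) / g ξ t ^ 3) / g ξ t))
    (fun ξ t h0 h1 => J.rpos ξ t h0.le h1) (fun ξ t => by simp only [J.fper, J.gper])
    (by
      refine continuousOn_const.sub ((J.fc.log ?_).sub (J.gc.log ?_))
      · intro z hz; exact (J.fpos _ _ hz.2.1 hz.2.2).ne'
      · intro z hz; exact (J.gpos _ _ hz.2.1 hz.2.2).ne')
    (fun ξ t h0 h1 => ((log_deriv (f := fun x => f x t) (g := fun x => g x t) (J.fpos ξ t h0.le h1) (J.gpos ξ t h0.le h1)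
      (J.fs ξ t h0 h1) (J.gs ξ t h0 h1)).const_sub _).congr_deriv (by ring))
    (fun ξ t h0 h1 => ((U_deriv (f := fun x => f x t) (g := fun x => g x t)
      (p := fun x => p x t) (q := fun x => q x t) (J.fpos ξ t h0.le h1) (J.gpos ξ t h0.le h1)
      (J.fs ξ t h0 h1) (J.gs ξ t h0 h1) (J.ps ξ t h0 h1) (J.qs ξ t h0 h1)).neg).congr_deriv
        (by ring))
    J.rd
    (fun ξ t h0 h1 => (log_deriv (f := fun τ => f ξ τ) (g := fun τ => g ξ τ)
      (J.fpos ξ t h0.le h1) (J.gpos ξ t h0.le h1) (J.ft ξ t h0 h1) (J.gt ξ t h0 h1)).const_sub _)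
    (by
      intro ξ
      have hg := J.gpos ξ 0 le_rfl hT
      have := Real.log_le_log (by positivity) (hi ξ)
      rw [Real.log_mul hx.ne' hg.ne'] at this
      linarith)
    (by
      intro ξ t h0 h1 hpos hs hss
      have hf := J.fpos ξ t h0.le h1
      have hg := J.gpos ξ t h0.le h1
      have hlt : f ξ t < x0 * g ξ t := by
        apply (Real.log_lt_log_iff hf (by positivity)).1
        rw [Real.log_mul hx.ne' hg.ne']
        linarith
      have hlt2 : f ξ t < g ξ t := by nlinarith
      have hsq : f ξ t ^ 2 < g ξ t ^ 2 := pow_lt_pow_left₀ hlt2 hf.le (by norm_num)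
      have h3 : 0 < 4 * (g ξ t ^ 2 - f ξ t ^ 2) / g ξ t ^ 4 :=
        div_pos (by linarith) (by positivity)
      have := key_log (k := k ξ t) (l := l ξ t) hf hg (neg_eq_zero.1 hs)
      linarith) ξ t h0 h1
  have hg := J.gpos ξ t h0 h1
  have hf := J.fpos ξ t h0 h1
  apply (Real.log_le_log_iff (by positivity) hf).1
  rw [Real.log_mul hx.ne' hg.ne']
  linarith

lemma stepD {T : ℝ} {f g ρ p q k l k3 l3 k4 : ℝ → ℝ → ℝ}
    (J : Jet T f g ρ p q k l k3 l3 k4) (hfg : ∀ ξ t, 0 ≤ t → t < T → f ξ t ≤ g ξ t)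
    (hi : ∀ ξ, |p ξ 0| ≤ 1) :
    ∀ ξ t, 0 ≤ t → t < T → p ξ t ^ 2 ≤ 4 / 3 := by
  obtain ⟨B, hB1, hB2⟩ : ∃ B : ℝ, 1 ≤ B ∧ B ^ 2 = 4 / 3 :=
    ⟨Real.sqrt (4 / 3), Real.one_le_sqrt.2 (by norm_num), Real.sq_sqrt (by norm_num)⟩
  have main : ∀ σ : ℝ, (σ = 1 ∨ σ = -1) → ∀ ξ t, 0 ≤ t → t < T → σ * p ξ t - B ≤ 0 := by
    intro σ hσ
    refine max_principle (T := T) (a := 0) (ρ := ρ) (Φ := fun ξ t => σ * p ξ t - B)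
      (Φs := fun ξ t => σ * k ξ t) (Φss := fun ξ t => σ * k3 ξ t)
      (Φt := fun ξ t => σ * (k3 ξ t + (2 * (q ξ t / g ξ t) - p ξ t / f ξ t) * k ξ t
      - (2 * q ξ t ^ 2 / g ξ t ^ 2 + 6 * f ξ t ^ 2 / g ξ t ^ 4) * p ξ t
      + 8 * f ξ t ^ 3 * q ξ t / g ξ t ^ 5))
      (fun ξ t h0 h1 => J.rpos ξ t h0.le h1) (fun ξ t => by simp only [J.pper])
      ((continuousOn_const.mul J.pc).sub continuousOn_const)
      (fun ξ t h0 h1 => (((J.ps ξ t h0 h1).const_mul σ).sub_const B).congr_deriv (by ring))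
      (fun ξ t h0 h1 => ((J.ks ξ t h0 h1).const_mul σ).congr_deriv (by ring)) J.rd
      (fun ξ t h0 h1 => ((J.pt ξ t h0 h1).const_mul σ).sub_const B) ?_ ?_
    · intro ξ
      have := abs_le.1 (hi ξ)
      rcases hσ with rfl | rfl <;> linarith [this.1, this.2]
    · intro ξ t h0 h1 hpos hs hss
      have hf := J.fpos ξ t h0.le h1
      have hg := J.gpos ξ t h0.le h1
      have hh := hfg ξ t h0.le h1
      have h4 : 4 / 3 < (σ * p ξ t) ^ 2 := by nlinarith
      have := key_p (p := σ * p ξ t) (q := σ * q ξ t) (k := k ξ t) (k3 := σ * k3 ξ t)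
        hf hg hh (by linarith) h4 (by rcases hσ with rfl | rfl <;> linarith) hss
      rcases hσ with rfl | rfl
      · simpa only [one_mul] using this
      · refine lt_of_eq_of_lt ?_ this
        ring
  intro ξ t h0 h1
  have a1 := main 1 (Or.inl rfl) ξ t h0 h1
  have a2 := main (-1) (Or.inr rfl) ξ t h0 h1
  nlinarith

lemma stepE {T a : ℝ} {f g ρ p q k l k3 l3 k4 : ℝ → ℝ → ℝ} (ha : 0 < a) (haT : a < T)
    (J : Jet T f g ρ p q k l k3 l3 k4) (hfg : ∀ ξ t, 0 ≤ t → t < T → f ξ t ≤ g ξ t) :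
    ∃ G, 0 < G ∧ ∀ ξ t, a ≤ t → t < T → |q ξ t| ≤ G := by
  have hc := slice_cont (J.qc a ha) le_rfl haT
  obtain ⟨G0, hG0, hb⟩ := per_bdd hc.abs (fun ξ => by simp only [J.qper])
  refine ⟨G0 + 3, by linarith, ?_⟩
  have main : ∀ σ : ℝ, (σ = 1 ∨ σ = -1) → ∀ ξ t, a ≤ t → t < T → σ * q ξ t - (G0 + 3) ≤ 0 := by
    intro σ hσ
    refine max_principle (T := T) (a := a) (ρ := ρ) (Φ := fun ξ t => σ * q ξ t - (G0 + 3))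
      (Φs := fun ξ t => σ * l ξ t) (Φss := fun ξ t => σ * l3 ξ t)
      (Φt := fun ξ t => σ * (l3 ξ t + p ξ t / f ξ t * l ξ t
      - (p ξ t ^ 2 / f ξ t ^ 2 + q ξ t ^ 2 / g ξ t ^ 2) * q ξ t
      + (4 * g ξ t ^ 2 - 6 * f ξ t ^ 2) * q ξ t / g ξ t ^ 4
      + 4 * f ξ t * p ξ t / g ξ t ^ 3))
      (fun ξ t h0 h1 => J.rpos ξ t (ha.trans h0).le h1) (fun ξ t => by simp only [J.qper])
      ((continuousOn_const.mul (J.qc a ha)).sub continuousOn_const)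
      (fun ξ t h0 h1 =>
        (((J.qs ξ t (ha.trans h0) h1).const_mul σ).sub_const _).congr_deriv (by ring))
      (fun ξ t h0 h1 => ((J.ls ξ t (ha.trans h0) h1).const_mul σ).congr_deriv (by ring))
      (fun ξ t h0 h1 => J.rd ξ t (ha.trans h0) h1)
      (fun ξ t h0 h1 => ((J.qt ξ t (ha.trans h0) h1).const_mul σ).sub_const _) ?_ ?_
    · intro ξ
      have := abs_le.1 (hb ξ)
      rcases hσ with rfl | rfl <;> linarith [this.1, this.2]
    · intro ξ t h0 h1 hpos hs hss
      have h0' := ha.trans h0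
      have hf := J.fpos ξ t h0'.le h1
      have hg := J.gpos ξ t h0'.le h1
      have hh := hfg ξ t h0'.le h1
      have := key_q (p := σ * p ξ t) (q := σ * q ξ t) (l := l ξ t) (l3 := σ * l3 ξ t)
        hf hg hh (by linarith) (by rcases hσ with rfl | rfl <;> linarith) hss
      rcases hσ with rfl | rfl
      · simpa only [one_mul] using this
      · refine lt_of_eq_of_lt ?_ this
        ring
  intro ξ t h0 h1
  have a1 := main 1 (Or.inl rfl) ξ t h0 h1
  have a2 := main (-1) (Or.inr rfl) ξ t h0 h1
  rw [abs_le]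
  constructor <;> linarith

lemma stepF {T a : ℝ} {f g ρ p q k l k3 l3 k4 : ℝ → ℝ → ℝ} (ha : 0 < a) (haT : a < T)
    (J : Jet T f g ρ p q k l k3 l3 k4) (hfg : ∀ ξ t, 0 ≤ t → t < T → f ξ t ≤ g ξ t)
    (hx : ∀ ξ t, 0 ≤ t → t < T → 7 / 10 * g ξ t ≤ f ξ t)
    (hp : ∀ ξ t, 0 ≤ t → t < T → p ξ t ^ 2 ≤ 4 / 3) :
    ∃ D, 0 < D ∧ ∀ ξ t, a ≤ t → t < T → g ξ t / f ξ t - 1 ≤ D * f ξ t := by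
  have fca := cont_mono ha.le J.fc
  have gca := cont_mono ha.le J.gc
  have fs := slice_cont fca le_rfl haT
  have gs := slice_cont gca le_rfl haT
  have hfa : ∀ ξ, 0 < f ξ a := fun ξ => J.fpos ξ a ha.le haT
  obtain ⟨D, hD, hb⟩ := per_bdd (φ := fun ξ => (g ξ a / f ξ a - 1) / f ξ a)
    (((gs.div fs (fun ξ => (hfa ξ).ne')).sub continuous_const).div fs (fun ξ => (hfa ξ).ne'))
    (fun ξ => by simp only [J.fper, J.gper])
  refine ⟨D, hD, ?_⟩
  have main : ∀ ξ t, a ≤ t → t < T → g ξ t / f ξ t - 1 - D * f ξ t ≤ 0 := by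
    refine max_principle (T := T) (a := a) (ρ := ρ)
      (Φ := fun ξ t => g ξ t / f ξ t - 1 - D * f ξ t)
      (Φs := fun ξ t => q ξ t / f ξ t - g ξ t * p ξ t / f ξ t ^ 2 - D * p ξ t)
      (Φss := fun ξ t => l ξ t / f ξ t - 2 * q ξ t * p ξ t / f ξ t ^ 2 - g ξ t * k ξ t / f ξ t ^ 2
        + 2 * g ξ t * p ξ t ^ 2 / f ξ t ^ 3 - D * k ξ t)
      (Φt := fun ξ t => (l ξ t + (p ξ t / f ξ t + q ξ t / g ξ t) * q ξ t
          + 2 * (f ξ t ^ 2 - 2 * g ξ t ^ 2) / g ξ t ^ 3) / f ξ t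
        - g ξ t * (k ξ t + 2 * (q ξ t / g ξ t) * p ξ t - 2 * f ξ t ^ 3 / g ξ t ^ 4) / f ξ t ^ 2
        - D * (k ξ t + 2 * (q ξ t / g ξ t) * p ξ t - 2 * f ξ t ^ 3 / g ξ t ^ 4))
      (fun ξ t h0 h1 => J.rpos ξ t (ha.trans h0).le h1) (fun ξ t => by simp only [J.fper, J.gper])
      (((gca.div fca (fun z hz => (J.fpos _ _ (ha.le.trans hz.2.1) hz.2.2).ne')).sub
        continuousOn_const).sub (continuousOn_const.mul fca)) ?_ ?_
      (fun ξ t h0 h1 => J.rd ξ t (ha.trans h0) h1) ?_ ?_ ?_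
    · intro ξ t h0 h1
      have h0' := ha.trans h0
      have hf := J.fpos ξ t h0'.le h1
      refine ((((J.gs ξ t h0' h1).div (J.fs ξ t h0' h1) hf.ne').sub_const 1).sub
        ((J.fs ξ t h0' h1).const_mul D)).congr_deriv ?_
      field_simp
    · intro ξ t h0 h1
      have h0' := ha.trans h0
      have hf := J.fpos ξ t h0'.le h1
      refine ((((J.qs ξ t h0' h1).div (J.fs ξ t h0' h1) hf.ne').sub
        (((J.gs ξ t h0' h1).mul (J.ps ξ t h0' h1)).div ((J.fs ξ t h0' h1).pow 2)
          (pow_pos hf 2).ne')).sub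
        ((J.ps ξ t h0' h1).const_mul D)).congr_deriv ?_
      simp only [Pi.mul_apply, Pi.div_apply, Pi.pow_apply, Pi.add_apply, Pi.sub_apply]
      push_cast
      field_simp
      ring
    · intro ξ t h0 h1
      have h0' := ha.trans h0
      have hf := J.fpos ξ t h0'.le h1
      refine ((((J.gt ξ t h0' h1).div (J.ft ξ t h0' h1) hf.ne').sub_const 1).sub
        ((J.ft ξ t h0' h1).const_mul D)).congr_deriv ?_
      congr 1
      rw [sub_div]
      congr 1
      rw [div_eq_div_iff (by positivity) (by positivity)]
      ring
    · intro ξ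
      have := (div_le_iff₀ (hfa ξ)).1 (hb ξ)
      linarith
    · intro ξ t h0 h1 hpos hs hss
      have h0' := (ha.trans h0).le
      exact key_gf (J.fpos ξ t h0' h1) (J.gpos ξ t h0' h1) (hfg ξ t h0' h1) (hx ξ t h0' h1) hD
        (hp ξ t h0' h1) hpos hs hss
  intro ξ t h0 h1
  linarith [main ξ t h0 h1]

lemma U_deriv2 {f g p q k l : ℝ → ℝ} {x f' g' p' q' k' l' : ℝ} (hf : 0 < f x) (hg : 0 < g x)
    (h1 : HasDerivAt f f' x) (h2 : HasDerivAt g g' x)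
    (h3 : HasDerivAt p p' x) (h4 : HasDerivAt q q' x)
    (h5 : HasDerivAt k k' x) (h6 : HasDerivAt l l' x) :
    HasDerivAt (fun x => k x / f x - p x ^ 2 / f x ^ 2 - l x / g x + q x ^ 2 / g x ^ 2)
      ((k' / f x - k x * f' / f x ^ 2) - (2 * p x * p' / f x ^ 2 - 2 * p x ^ 2 * f' / f x ^ 3)
       - (l' / g x - l x * g' / g x ^ 2) + (2 * q x * q' / g x ^ 2 - 2 * q x ^ 2 * g' / g x ^ 3))
      x := by
  refine ((((h5.div h1 hf.ne').sub ((h3.pow 2).div (h1.pow 2) (pow_pos hf 2).ne')).sub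
    (h6.div h2 hg.ne')).add ((h4.pow 2).div (h2.pow 2) (pow_pos hg 2).ne')).congr_deriv ?_
  simp only [Pi.pow_apply]
  push_cast
  field_simp

/-- `U = (log f - log g)_s` and its derivatives -/
structure UJet (T : ℝ) (f g ρ p q k l k3 l3 U U1 U2 : ℝ → ℝ → ℝ) : Prop where
  u : ∀ ξ t, U ξ t = p ξ t / f ξ t - q ξ t / g ξ t
  u1 : ∀ ξ t, U1 ξ t = k ξ t / f ξ t - p ξ t ^ 2 / f ξ t ^ 2 - l ξ t / g ξ t
      + q ξ t ^ 2 / g ξ t ^ 2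
  u2 : ∀ ξ t, U2 ξ t = k3 ξ t / f ξ t - 3 * p ξ t * k ξ t / f ξ t ^ 2 + 2 * p ξ t ^ 3 / f ξ t ^ 3
      - l3 ξ t / g ξ t + 3 * q ξ t * l ξ t / g ξ t ^ 2 - 2 * q ξ t ^ 3 / g ξ t ^ 3
  us : ∀ ξ t : ℝ, 0 < t → t < T → HasDerivAt (fun x => U x t) (U1 ξ t * ρ ξ t) ξ
  u1s : ∀ ξ t : ℝ, 0 < t → t < T → HasDerivAt (fun x => U1 x t) (U2 ξ t * ρ ξ t) ξ
  ut : ∀ ξ t : ℝ, 0 < t → t < T → HasDerivAt (fun τ => U ξ τ)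
    (U2 ξ t + (p ξ t / f ξ t + 2 * (q ξ t / g ξ t)) * U1 ξ t
      - (p ξ t ^ 2 / f ξ t ^ 2 + 2 * q ξ t ^ 2 / g ξ t ^ 2 + 8 * f ξ t ^ 2 / g ξ t ^ 4)
        * (p ξ t / f ξ t - q ξ t / g ξ t)
      - 8 * q ξ t / g ξ t ^ 3 * (1 - f ξ t ^ 2 / g ξ t ^ 2)) t

lemma ujet_of {T : ℝ} {f g ρ p q k l k3 l3 k4 : ℝ → ℝ → ℝ}
    (J : Jet T f g ρ p q k l k3 l3 k4) : ∃ U U1 U2, UJet T f g ρ p q k l k3 l3 U U1 U2 := by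
  refine ⟨fun ξ t => p ξ t / f ξ t - q ξ t / g ξ t, fun ξ t => k ξ t / f ξ t
      - p ξ t ^ 2 / f ξ t ^ 2 - l ξ t / g ξ t + q ξ t ^ 2 / g ξ t ^ 2,
      fun ξ t => k3 ξ t / f ξ t - 3 * p ξ t * k ξ t / f ξ t ^ 2 + 2 * p ξ t ^ 3 / f ξ t ^ 3
      - l3 ξ t / g ξ t + 3 * q ξ t * l ξ t / g ξ t ^ 2 - 2 * q ξ t ^ 3 / g ξ t ^ 3,
      fun _ _ => rfl, fun _ _ => rfl, fun _ _ => rfl, ?_, ?_, ?_⟩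
  · intro ξ t h0 h1
    exact (U_deriv (f := fun x => f x t) (g := fun x => g x t)
      (p := fun x => p x t) (q := fun x => q x t) (J.fpos ξ t h0.le h1) (J.gpos ξ t h0.le h1)
      (J.fs ξ t h0 h1) (J.gs ξ t h0 h1) (J.ps ξ t h0 h1) (J.qs ξ t h0 h1)).congr_deriv (by ring)
  · intro ξ t h0 h1
    exact (U_deriv2 (f := fun x => f x t) (g := fun x => g x t)
      (p := fun x => p x t) (q := fun x => q x t) (k := fun x => k x t) (l := fun x => l x t)
      (J.fpos ξ t h0.le h1) (J.gpos ξ t h0.le h1)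
      (J.fs ξ t h0 h1) (J.gs ξ t h0 h1) (J.ps ξ t h0 h1) (J.qs ξ t h0 h1)
      (J.ks ξ t h0 h1) (J.ls ξ t h0 h1)).congr_deriv (by ring)
  · intro ξ t h0 h1
    have hf := J.fpos ξ t h0.le h1
    have hg := J.gpos ξ t h0.le h1
    refine (U_deriv (f := fun x => f ξ x) (g := fun x => g ξ x)
      (p := fun x => p ξ x) (q := fun x => q ξ x) hf hg
      (J.ft ξ t h0 h1) (J.gt ξ t h0 h1) (J.pt ξ t h0 h1) (J.qt ξ t h0 h1)).congr_deriv ?_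
    exact U_evol hf hg

lemma UJet.cont {T a : ℝ} {f g ρ p q k l k3 l3 k4 U U1 U2 : ℝ → ℝ → ℝ}
    (J : Jet T f g ρ p q k l k3 l3 k4) (V : UJet T f g ρ p q k l k3 l3 U U1 U2) (ha : 0 < a) :
    ContinuousOn (fun z : ℝ × ℝ => U z.1 z.2) (univ ×ˢ Ico a T) := by
  simp only [V.u]
  exact ((cont_mono ha.le J.pc).div (cont_mono ha.le J.fc)
    (fun z hz => (J.fpos _ _ (ha.le.trans hz.2.1) hz.2.2).ne')).sub
    ((J.qc a ha).div (cont_mono ha.le J.gc)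
    (fun z hz => (J.gpos _ _ (ha.le.trans hz.2.1) hz.2.2).ne'))

lemma stepG {T a D G : ℝ} {f g ρ p q k l k3 l3 k4 U U1 U2 : ℝ → ℝ → ℝ} (ha : 0 < a) (haT : a < T)
    (J : Jet T f g ρ p q k l k3 l3 k4) (V : UJet T f g ρ p q k l k3 l3 U U1 U2)
    (hfg : ∀ ξ t, 0 ≤ t → t < T → f ξ t ≤ g ξ t)
    (hG : 0 < G) (hq : ∀ ξ t, a ≤ t → t < T → |q ξ t| ≤ G)
    (hD : 0 < D) (hgf : ∀ ξ t, a ≤ t → t < T → g ξ t / f ξ t - 1 ≤ D * f ξ t) :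
    ∃ C, 0 < C ∧ ∀ ξ t, a ≤ t → t < T → |U ξ t| ≤ C := by
  have Uper : ∀ ξ t, U (ξ + 2 * π) t = U ξ t := by
    intro ξ t; simp only [V.u, J.fper, J.gper, J.pper, J.qper]
  have hc := slice_cont (V.cont J ha) le_rfl haT
  obtain ⟨C0, hC0, hb⟩ := per_bdd hc.abs (fun ξ => by simp only [Uper])
  have hGD : 0 < 2 * G * D := by positivity
  refine ⟨C0 + 2 * G * D, by linarith, ?_⟩
  have main : ∀ σ : ℝ, (σ = 1 ∨ σ = -1) → ∀ ξ t, a ≤ t → t < T →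
      σ * U ξ t - (C0 + 2 * G * D) ≤ 0 := by
    intro σ hσ
    refine max_principle (T := T) (a := a) (ρ := ρ) (Φ := fun ξ t => σ * U ξ t - (C0 + 2 * G * D))
      (Φs := fun ξ t => σ * U1 ξ t) (Φss := fun ξ t => σ * U2 ξ t)
      (Φt := fun ξ t => σ * (U2 ξ t + (p ξ t / f ξ t + 2 * (q ξ t / g ξ t)) * U1 ξ t
      - (p ξ t ^ 2 / f ξ t ^ 2 + 2 * q ξ t ^ 2 / g ξ t ^ 2 + 8 * f ξ t ^ 2 / g ξ t ^ 4)
        * (p ξ t / f ξ t - q ξ t / g ξ t)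
      - 8 * q ξ t / g ξ t ^ 3 * (1 - f ξ t ^ 2 / g ξ t ^ 2)))
      (fun ξ t h0 h1 => J.rpos ξ t (ha.trans h0).le h1) (fun ξ t => by simp only [Uper])
      ((continuousOn_const.mul (V.cont J ha)).sub continuousOn_const)
      (fun ξ t h0 h1 =>
        (((V.us ξ t (ha.trans h0) h1).const_mul σ).sub_const _).congr_deriv (by ring))
      (fun ξ t h0 h1 => ((V.u1s ξ t (ha.trans h0) h1).const_mul σ).congr_deriv (by ring))
      (fun ξ t h0 h1 => J.rd ξ t (ha.trans h0) h1)
      (fun ξ t h0 h1 => ((V.ut ξ t (ha.trans h0) h1).const_mul σ).sub_const _) ?_ ?_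
    · intro ξ
      have := abs_le.1 (hb ξ)
      rcases hσ with rfl | rfl <;> linarith [this.1, this.2]
    · intro ξ t h0 h1 hpos hs hss
      have h0' := ha.trans h0
      have hf := J.fpos ξ t h0'.le h1
      have hg := J.gpos ξ t h0'.le h1
      have hh := hfg ξ t h0'.le h1
      have hq' : |σ * q ξ t| ≤ G := by
        rcases hσ with rfl | rfl
        · simpa using hq ξ t h0.le h1
        · simpa using hq ξ t h0.le h1
      have hs1 : U1 ξ t = 0 := by rcases hσ with rfl | rfl <;> linarith
      have := key_U (p := σ * p ξ t) (q := σ * q ξ t) (U1 := U1 ξ t) (U2 := σ * U2 ξ t)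
        (C := C0 + 2 * G * D)
        hf hg hh hq' (hgf ξ t h0.le h1) hD hG (by linarith) (by
          rw [V.u] at hpos
          have e : σ * p ξ t / f ξ t - σ * q ξ t / g ξ t
            = σ * (p ξ t / f ξ t - q ξ t / g ξ t) := by ring
          rw [e]; linarith) hs1 hss
      rcases hσ with rfl | rfl
      · simpa only [one_mul] using this
      · refine lt_of_eq_of_lt ?_ this
        ring
  intro ξ t h0 h1
  have a1 := main 1 (Or.inl rfl) ξ t h0 h1
  have a2 := main (-1) (Or.inr rfl) ξ t h0 h1
  rw [abs_le]
  constructor <;> linarith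

lemma stepH {T a C : ℝ} {f g ρ p q k l k3 l3 k4 U U1 U2 : ℝ → ℝ → ℝ} (ha : 0 < a) (haT : a < T)
    (J : Jet T f g ρ p q k l k3 l3 k4) (V : UJet T f g ρ p q k l k3 l3 U U1 U2)
    (hfg : ∀ ξ t, 0 ≤ t → t < T → f ξ t ≤ g ξ t)
    (hC : 0 < C) (hU : ∀ ξ t, a ≤ t → t < T → |U ξ t| ≤ C) :
    ∃ A, 0 < A ∧ ∀ ξ t, a ≤ t → t < T → |p ξ t| ≤ 1 + A * f ξ t := by
  have fca := cont_mono ha.le J.fc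
  have pca := cont_mono ha.le J.pc
  have fs := slice_cont fca le_rfl haT
  have ps := slice_cont pca le_rfl haT
  have hfa : ∀ ξ, 0 < f ξ a := fun ξ => J.fpos ξ a ha.le haT
  obtain ⟨A0, hA0, hb⟩ := per_bdd (φ := fun ξ => |p ξ a| / f ξ a)
    (ps.abs.div fs (fun ξ => (hfa ξ).ne')) (fun ξ => by simp only [J.fper, J.pper])
  refine ⟨A0 + 5 * C, by linarith, ?_⟩
  have main : ∀ σ : ℝ, (σ = 1 ∨ σ = -1) → ∀ ξ t, a ≤ t → t < T →
      σ * p ξ t - 1 - (A0 + 5 * C) * f ξ t ≤ 0 := by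
    intro σ hσ
    refine max_principle (T := T) (a := a) (ρ := ρ)
      (Φ := fun ξ t => σ * p ξ t - 1 - (A0 + 5 * C) * f ξ t)
      (Φs := fun ξ t => σ * k ξ t - (A0 + 5 * C) * p ξ t)
      (Φss := fun ξ t => σ * k3 ξ t - (A0 + 5 * C) * k ξ t)
      (Φt := fun ξ t => σ * (k3 ξ t + (2 * (q ξ t / g ξ t) - p ξ t / f ξ t) * k ξ t
        - (2 * q ξ t ^ 2 / g ξ t ^ 2 + 6 * f ξ t ^ 2 / g ξ t ^ 4) * p ξ t
        + 8 * f ξ t ^ 3 * q ξ t / g ξ t ^ 5)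
        - (A0 + 5 * C) * (k ξ t + 2 * (q ξ t / g ξ t) * p ξ t - 2 * f ξ t ^ 3 / g ξ t ^ 4))
      (fun ξ t h0 h1 => J.rpos ξ t (ha.trans h0).le h1) (fun ξ t => by simp only [J.fper, J.pper])
      (((continuousOn_const.mul pca).sub continuousOn_const).sub (continuousOn_const.mul fca))
      (fun ξ t h0 h1 =>
        ((((J.ps ξ t (ha.trans h0) h1).const_mul σ).sub_const 1).sub
          ((J.fs ξ t (ha.trans h0) h1).const_mul _)).congr_deriv (by ring))
      (fun ξ t h0 h1 => (((J.ks ξ t (ha.trans h0) h1).const_mul σ).sub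
          ((J.ps ξ t (ha.trans h0) h1).const_mul _)).congr_deriv (by ring))
      (fun ξ t h0 h1 => J.rd ξ t (ha.trans h0) h1)
      (fun ξ t h0 h1 => (((J.pt ξ t (ha.trans h0) h1).const_mul σ).sub_const 1).sub
          ((J.ft ξ t (ha.trans h0) h1).const_mul _)) ?_ ?_
    · intro ξ
      have h3 := (div_le_iff₀ (hfa ξ)).1 (hb ξ)
      have h4 : 0 < 5 * C * f ξ a := mul_pos (by linarith) (hfa ξ)
      have h5 : σ * p ξ a ≤ |p ξ a| := by
        rcases hσ with rfl | rfl
        · simpa using le_abs_self (p ξ a)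
        · simpa using neg_le_abs (p ξ a)
      linarith
    · intro ξ t h0 h1 hpos hs hss
      have h0' := ha.trans h0
      have hf := J.fpos ξ t h0'.le h1
      have hg := J.gpos ξ t h0'.le h1
      have hh := hfg ξ t h0'.le h1
      have hσ2 : σ * σ = 1 := by rcases hσ with rfl | rfl <;> norm_num
      have hU' : |σ * p ξ t / f ξ t - σ * q ξ t / g ξ t| ≤ C := by
        have e : σ * p ξ t / f ξ t - σ * q ξ t / g ξ t
            = σ * U ξ t := by rw [V.u]; ring
        rw [e]
        rcases hσ with rfl | rfl
        · simpa using hU ξ t h0.le h1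
        · simpa using hU ξ t h0.le h1
      have hs1 : k ξ t - (A0 + 5 * C) * (σ * p ξ t) = 0 := by
        rcases hσ with rfl | rfl <;> linarith
      have := key_p1 (p := σ * p ξ t) (q := σ * q ξ t) (k := k ξ t) (k3 := σ * k3 ξ t)
        (A := A0 + 5 * C) hf hg hh hC hU' (by linarith) hpos hs1 hss
      rcases hσ with rfl | rfl
      · simpa only [one_mul] using this
      · refine lt_of_eq_of_lt ?_ this
        ring
  intro ξ t h0 h1
  have a1 := main 1 (Or.inl rfl) ξ t h0 h1
  have a2 := main (-1) (Or.inr rfl) ξ t h0 h1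
  rw [abs_le]
  constructor <;> linarith

lemma Y_deriv {f k U : ℝ → ℝ} {x f' k' U' c0 C : ℝ} (hf : 0 < f x)
    (h1 : HasDerivAt f f' x) (h2 : HasDerivAt k k' x) (h3 : HasDerivAt U U' x) :
    HasDerivAt (fun x => (c0 - Real.log (f x)) * f x * k x + f x * U x ^ 2 - C)
      ((c0 - Real.log (f x) - 1) * f' * k x + (c0 - Real.log (f x)) * f x * k' + f' * U x ^ 2
        + 2 * f x * U x * U') x := by
  refine ((((((h1.log hf.ne').const_sub c0).mul h1).mul h2).add
    (h1.mul (h3.pow 2))).sub_const C).congr_deriv ?_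
  simp only [Pi.mul_apply, Pi.pow_apply]
  push_cast
  field_simp
  ring

lemma Y_deriv2 {f p k k3 U U1 : ℝ → ℝ} {x f' p' k' k3' U' U1' c0 : ℝ} (hf : 0 < f x)
    (h1 : HasDerivAt f f' x) (h2 : HasDerivAt k k' x) (h3 : HasDerivAt U U' x)
    (h4 : HasDerivAt p p' x) (h5 : HasDerivAt k3 k3' x) (h6 : HasDerivAt U1 U1' x) :
    HasDerivAt (fun x => (c0 - Real.log (f x) - 1) * p x * k x + (c0 - Real.log (f x)) * f x * k3 x
        + p x * U x ^ 2 + 2 * f x * U x * U1 x)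
      (-(f' / f x) * p x * k x + (c0 - Real.log (f x) - 1) * (p' * k x + p x * k')
        + (c0 - Real.log (f x) - 1) * f' * k3 x + (c0 - Real.log (f x)) * f x * k3'
        + p' * U x ^ 2 + 2 * p x * U x * U' + 2 * f' * U x * U1 x + 2 * f x * U' * U1 x
        + 2 * f x * U x * U1') x := by
  have hl := (h1.log hf.ne').const_sub c0
  refine ((((((hl.sub_const 1).mul h4).mul h2).add ((hl.mul h1).mul h5)).add
    (h4.mul (h3.pow 2))).add (((h1.const_mul 2).mul h3).mul h6)).congr_deriv ?_
  simp only [Pi.mul_apply, Pi.pow_apply]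
  push_cast
  field_simp
  ring

lemma stepI {T a c c0 : ℝ} {f g ρ p q k l k3 l3 k4 U U1 U2 : ℝ → ℝ → ℝ} (ha : 0 < a) (haT : a < T)
    (J : Jet T f g ρ p q k l k3 l3 k4) (V : UJet T f g ρ p q k l k3 l3 U U1 U2)
    (hfg : ∀ ξ t, 0 ≤ t → t < T → f ξ t ≤ g ξ t) (hc : 1 ≤ c)
    (hfc : ∀ ξ t, a ≤ t → t < T → f ξ t ≤ c)
    (hU : ∀ ξ t, a ≤ t → t < T → |U ξ t| ≤ c)
    (hd : ∀ ξ t, a ≤ t → t < T → 1 - f ξ t ^ 2 / g ξ t ^ 2 ≤ c * f ξ t)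
    (hp2 : ∀ ξ t, a ≤ t → t < T → p ξ t ^ 2 ≤ 1 + c * f ξ t)
    (hp : ∀ ξ t, a ≤ t → t < T → |p ξ t| ≤ 2)
    (hL : ∀ ξ t, a ≤ t → t < T → 1 ≤ c0 - Real.log (f ξ t))
    (hLf : ∀ ξ t, a ≤ t → t < T → (c0 - Real.log (f ξ t)) ^ 3 * f ξ t ≤ c) :
    ∃ C, 0 < C ∧ ∀ ξ t, a ≤ t → t < T →
      (c0 - Real.log (f ξ t)) * f ξ t * k ξ t ≤ C := by
  have Uper : ∀ ξ t, U (ξ + 2 * π) t = U ξ t := by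
    intro ξ t; simp only [V.u, J.fper, J.gper, J.pper, J.qper]
  have fca := cont_mono ha.le J.fc
  have kca := J.kc a ha
  have Uca := V.cont J ha
  have Yc : ContinuousOn (fun z : ℝ × ℝ => (c0 - Real.log (f z.1 z.2)) * f z.1 z.2 * k z.1 z.2
      + f z.1 z.2 * U z.1 z.2 ^ 2) (univ ×ˢ Ico a T) :=
    (((continuousOn_const.sub (fca.log
      (fun z hz => (J.fpos _ _ (ha.le.trans hz.2.1) hz.2.2).ne'))).mul fca).mul kca).add
      (fca.mul (Uca.pow 2))
  obtain ⟨C0, hC0, hb⟩ := per_bdd (slice_cont (Φ := fun ξ t =>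
      (c0 - Real.log (f ξ t)) * f ξ t * k ξ t + f ξ t * U ξ t ^ 2) Yc le_rfl haT)
    (fun ξ => by simp only [J.fper, J.kper, Uper])
  have hc3 : 0 < 51 * c ^ 3 := by positivity
  refine ⟨C0 + 51 * c ^ 3, by linarith, ?_⟩
  have main : ∀ ξ t, a ≤ t → t < T → (c0 - Real.log (f ξ t)) * f ξ t * k ξ t + f ξ t * U ξ t ^ 2
      - (C0 + 51 * c ^ 3) ≤ 0 := by
    refine max_principle (T := T) (a := a) (ρ := ρ)
      (Φ := fun ξ t => (c0 - Real.log (f ξ t)) * f ξ t * k ξ t + f ξ t * U ξ t ^ 2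
        - (C0 + 51 * c ^ 3))
      (Φs := fun ξ t => (c0 - Real.log (f ξ t) - 1) * p ξ t * k ξ t
        + (c0 - Real.log (f ξ t)) * f ξ t * k3 ξ t
        + p ξ t * U ξ t ^ 2 + 2 * f ξ t * U ξ t * U1 ξ t)
      (Φss := fun ξ t => ((c0 - Real.log (f ξ t) - 1) * k ξ t - p ξ t ^ 2 / f ξ t) * k ξ t
        + 2 * (c0 - Real.log (f ξ t) - 1) * p ξ t * k3 ξ t
        + (c0 - Real.log (f ξ t)) * f ξ t * k4 ξ t + k ξ t * U ξ t ^ 2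
        + 4 * p ξ t * U ξ t * U1 ξ t + 2 * f ξ t * U1 ξ t ^ 2 + 2 * f ξ t * U ξ t * U2 ξ t)
      (Φt := fun ξ t => (c0 - Real.log (f ξ t) - 1)
        * (k ξ t + 2 * (q ξ t / g ξ t) * p ξ t - 2 * f ξ t ^ 3 / g ξ t ^ 4) * k ξ t
        + (c0 - Real.log (f ξ t)) * f ξ t
         * (k4 ξ t + (2 * (q ξ t / g ξ t) - p ξ t / f ξ t) * k3 ξ t
      - 2 * k ξ t ^ 2 / f ξ t
      + k ξ t * (p ξ t ^ 2 / f ξ t ^ 2 - 4 * q ξ t ^ 2 / g ξ t ^ 2 - 6 * f ξ t ^ 2 / g ξ t ^ 4)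
      + l ξ t * (8 * f ξ t ^ 3 / g ξ t ^ 5 - 4 * p ξ t * q ξ t / g ξ t ^ 2)
      + 4 * p ξ t * q ξ t ^ 3 / g ξ t ^ 3 - 12 * f ξ t * p ξ t ^ 2 / g ξ t ^ 4
      + 48 * f ξ t ^ 2 * p ξ t * q ξ t / g ξ t ^ 5 - 40 * f ξ t ^ 3 * q ξ t ^ 2 / g ξ t ^ 6)
        + (k ξ t + 2 * (q ξ t / g ξ t) * p ξ t - 2 * f ξ t ^ 3 / g ξ t ^ 4) * U ξ t ^ 2
        + 2 * f ξ t * U ξ t * (U2 ξ t + (p ξ t / f ξ t + 2 * (q ξ t / g ξ t)) * U1 ξ t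
      - (p ξ t ^ 2 / f ξ t ^ 2 + 2 * q ξ t ^ 2 / g ξ t ^ 2 + 8 * f ξ t ^ 2 / g ξ t ^ 4)
        * (p ξ t / f ξ t - q ξ t / g ξ t)
      - 8 * q ξ t / g ξ t ^ 3 * (1 - f ξ t ^ 2 / g ξ t ^ 2)))
      (fun ξ t h0 h1 => J.rpos ξ t (ha.trans h0).le h1)
      (fun ξ t => by simp only [J.fper, J.kper, Uper])
      (Yc.sub continuousOn_const)
      (fun ξ t h0 h1 => (Y_deriv (f := fun x => f x t) (k := fun x => k x t) (U := fun x => U x t)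
        (J.fpos ξ t (ha.trans h0).le h1) (J.fs ξ t (ha.trans h0) h1) (J.ks ξ t (ha.trans h0) h1)
        (V.us ξ t (ha.trans h0) h1)).congr_deriv (by ring))
      (fun ξ t h0 h1 => (Y_deriv2 (f := fun x => f x t) (k := fun x => k x t) (U := fun x => U x t)
        (p := fun x => p x t) (k3 := fun x => k3 x t) (U1 := fun x => U1 x t)
        (J.fpos ξ t (ha.trans h0).le h1) (J.fs ξ t (ha.trans h0) h1) (J.ks ξ t (ha.trans h0) h1)
        (V.us ξ t (ha.trans h0) h1) (J.ps ξ t (ha.trans h0) h1) (J.k3s ξ t (ha.trans h0) h1)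
        (V.u1s ξ t (ha.trans h0) h1)).congr_deriv (by ring))
      (fun ξ t h0 h1 => J.rd ξ t (ha.trans h0) h1)
      (fun ξ t h0 h1 => Y_deriv (f := fun x => f ξ x) (k := fun x => k ξ x) (U := fun x => U ξ x)
        (J.fpos ξ t (ha.trans h0).le h1) (J.ft ξ t (ha.trans h0) h1) (J.kt ξ t (ha.trans h0) h1)
        (V.ut ξ t (ha.trans h0) h1)) ?_ ?_
    · intro ξ
      have := hb ξ
      linarith
    · intro ξ t h0 h1 hpos hs hss
      have h0' := ha.trans h0
      have hU' := hU ξ t h0.le h1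
      rw [V.u] at hU' hpos hs hss ⊢
      exact key_Y (J.fpos ξ t h0'.le h1) (J.gpos ξ t h0'.le h1) (hfg ξ t h0'.le h1) (V.u1 ξ t)
        (hfc ξ t h0.le h1) hc hU' (hd ξ t h0.le h1) (hp2 ξ t h0.le h1) (hp ξ t h0.le h1)
        (hL ξ t h0.le h1) (hLf ξ t h0.le h1) (by linarith) hs hss
  intro ξ t h0 h1
  have h3 := main ξ t h0 h1
  have h4 : 0 ≤ f ξ t * U ξ t ^ 2 :=
    mul_nonneg (J.fpos ξ t (ha.le.trans h0) h1).le (sq_nonneg _)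
  linarith

lemma log_cube {c0 x : ℝ} (hx : 0 < x) (hL : 0 ≤ c0 - Real.log x) :
    (c0 - Real.log x) ^ 3 * x ≤ 6 * Real.exp c0 := by
  have h := Real.pow_div_factorial_le_exp (c0 - Real.log x) hL 3
  rw [Real.exp_sub, Real.exp_log hx, le_div_iff₀ hx] at h
  norm_num [Nat.factorial] at h
  linarith

/-- Under Assumption B, for every sufficiently small `δ ∈ (0,1)` there
exist `t_δ ∈ [0,T)` and `C < ∞` such that `F := f·f_ss·log f ≥ −C` at every point of the
neck-like region `{t_δ < t < T, f ≤ δ, f_ss ≥ 0}`. -/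
theorem neck_F_lower_bound (T : ℝ) (f g ρ : ℝ → ℝ → ℝ)
    (sol : AssumptionB T f g ρ) :
    ∃ δ₀ : ℝ, 0 < δ₀ ∧ δ₀ ≤ 1 ∧ ∀ δ : ℝ, 0 < δ → δ < δ₀ →
      ∃ tδ C : ℝ, 0 ≤ tδ ∧ tδ < T ∧
        ∀ ξ t : ℝ, tδ < t → t < T → f ξ t ≤ δ → 0 ≤ Ds ρ (Ds ρ f) ξ t →
          -C ≤ f ξ t * Ds ρ (Ds ρ f) ξ t * Real.log (f ξ t) := by
  have hT := sol.T_pos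
  obtain ⟨q, l, k3, l3, k4, J⟩ := jet_of sol.toAssumptionA.toWarpedBerger
  obtain ⟨U, U1, U2, V⟩ := ujet_of J
  have ha : 0 < T / 2 := by linarith
  have haT : T / 2 < T := by linarith
  obtain ⟨F, hF, hfF⟩ := stepA hT J
  have hfg := stepB J sol.init_order hT
  obtain ⟨ε, hε0, hε1, hεp, hεi⟩ := sol.init_pinched
  have hx0 := stepC J (x0 := 1 - ε) (by linarith) (by linarith) hεi hT
  have hx7 : 7 / 10 ≤ 1 - ε := by
    by_contra hcon
    have h1 : 1 - ε ≤ 7 / 10 := (not_le.1 hcon).le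
    have h5 := pow_le_pow_left₀ (by linarith : 0 ≤ 1 - ε) h1 5
    have h4 := pow_le_pow_left₀ (by linarith : 0 ≤ 1 - ε) h1 4
    norm_num at h5 h4
    linarith
  have hx : ∀ ξ t, 0 ≤ t → t < T → 7 / 10 * g ξ t ≤ f ξ t := fun ξ t h0 h1 =>
    (mul_le_mul_of_nonneg_right hx7 (J.gpos ξ t h0 h1).le).trans (hx0 ξ t h0 h1)
  have hp := stepD J hfg sol.init_fs
  obtain ⟨G, hG, hq⟩ := stepE ha haT J hfg
  obtain ⟨D, hD, hgf⟩ := stepF ha haT J hfg hx hp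
  obtain ⟨C1, hC1, hU⟩ := stepG ha haT J V hfg hG hq hD hgf
  obtain ⟨A, hA, hpA⟩ := stepH ha haT J V hfg hC1 hU
  have hc0 : 0 ≤ |Real.log F| + 1 := by positivity
  have hlog : ∀ ξ t, T / 2 ≤ t → t < T → 1 ≤ |Real.log F| + 1 - Real.log (f ξ t) := by
    intro ξ t h0 h1
    have h3 := Real.log_le_log (J.fpos ξ t (ha.le.trans h0) h1) (hfF ξ t (ha.le.trans h0) h1)
    linarith [le_abs_self (Real.log F)]
  obtain ⟨c0, hc0d⟩ : ∃ c0, c0 = |Real.log F| + 1 := ⟨_, rfl⟩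
  rw [← hc0d] at hc0
  simp only [← hc0d] at hlog
  have hexp := Real.exp_pos c0
  have hAF : 0 < A ^ 2 * F := by positivity
  obtain ⟨c, hcd⟩ : ∃ c, c = 1 + F + C1 + 2 * D + (2 * A + A ^ 2 * F) + 6 * Real.exp c0 :=
    ⟨_, rfl⟩
  obtain ⟨C, hC, hfin⟩ := stepI (c := c) (c0 := c0) ha haT J V hfg (by linarith)
    (fun ξ t h0 h1 => (hfF ξ t (ha.le.trans h0) h1).trans (by linarith))
    (fun ξ t h0 h1 => (hU ξ t h0 h1).trans (by linarith))
    (by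
      intro ξ t h0 h1
      have hf := J.fpos ξ t (ha.le.trans h0) h1
      have hg := J.gpos ξ t (ha.le.trans h0) h1
      have hle := hfg ξ t (ha.le.trans h0) h1
      have h3 := hgf ξ t h0 h1
      have hx1 : f ξ t / g ξ t ≤ 1 := (div_le_one hg).2 hle
      have hx0 : 0 < f ξ t / g ξ t := by positivity
      have hy : f ξ t / g ξ t * (g ξ t / f ξ t) = 1 := by field_simp
      have h4 : 1 - f ξ t / g ξ t ≤ D * f ξ t := by
        have h5 : f ξ t / g ξ t * (g ξ t / f ξ t - 1) ≤ 1 * (D * f ξ t) :=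
          mul_le_mul hx1 h3 (by rw [sub_nonneg, one_le_div hf]; exact hle) (by norm_num)
        linarith
      have h6 : 1 - f ξ t ^ 2 / g ξ t ^ 2 ≤ 2 * D * f ξ t := by
        rw [← div_pow]
        nlinarith
      have h7 : 2 * D * f ξ t ≤ c * f ξ t := mul_le_mul_of_nonneg_right (by linarith) hf.le
      linarith)
    (by
      intro ξ t h0 h1
      have hf := J.fpos ξ t (ha.le.trans h0) h1
      have h3 := pow_le_pow_left₀ (abs_nonneg _) (hpA ξ t h0 h1) 2
      rw [sq_abs] at h3
      have h4 : A ^ 2 * f ξ t * f ξ t ≤ A ^ 2 * f ξ t * F :=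
        mul_le_mul_of_nonneg_left (hfF ξ t (ha.le.trans h0) h1) (by positivity)
      have h5 : (2 * A + A ^ 2 * F) * f ξ t ≤ c * f ξ t :=
        mul_le_mul_of_nonneg_right (by linarith) hf.le
      linarith)
    (by
      intro ξ t h0 h1
      have h3 := hp ξ t (ha.le.trans h0) h1
      exact abs_le_of_sq_le_sq (by linarith) (by norm_num))
    hlog
    (fun ξ t h0 h1 => (log_cube (J.fpos ξ t (ha.le.trans h0) h1)
      (by linarith [hlog ξ t h0 h1])).trans (by linarith))
  refine ⟨1, one_pos, le_rfl, fun δ _ _ => ⟨T / 2, C, ha.le, haT, ?_⟩⟩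
  intro ξ t h0 h1 _ hk
  have h2 := hfin ξ t h0.le h1
  have hf := J.fpos ξ t (ha.trans h0).le h1
  have h3 : 0 ≤ c0 * (f ξ t * Ds ρ (Ds ρ f) ξ t) := by positivity
  linarith
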